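/- The iterated one-box removal map Φ_1^m : ℱ_{λ,n} → Λ^m V ⊗ ℱ_{λ∖X,n} commutes with the GL_n(ℂ)-actions and satisfies Φ_1^m(R_{λ,n}) ⊆ Λ^m V ⊗ R_{λ∖X,n}; hence it descends to a GL_n(ℂ)-equivariant linear map ℱ_{λ,n}/R_{λ,n} → Λ^m V ⊗ (ℱ_{λ∖X,n}/R_{λ∖X,n}), i.e. a GL_n(ℂ)-map S_λ(V) → Λ^m V ⊗ S_{λ∖X}(V). -/

import Mathlib

/-!
Formalization of definitions from "Pieri inclusions" (arXiv:1911.11045).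

Cells `(r, j)` have row index `r` (counted from the *top*, `0`-based; so a cell is
geometrically *lower* than another iff its row index is *larger*) and column index `j`
(`0`-based).  A shape is a finite set `K` of cells; in the intended applications `K` is the
set of cells of a Young diagram (possibly with some boxes removed).  Blocks of a partition
are recovered as the (automatically contiguous) groups of rows of equal width.
-/

open scoped TensorProduct Classical

noncomputable section

namespace PieriPaper

/-! ### Shapes, tableaux, Garnir relations -/

/-- A cell `(r, j)`: row `r` (from the top, `0`-based), column `j` (`0`-based). -/
abbrev Cell : Type := ℕ × ℕ

/-- The boxes of the shape given by a finite set `K` of cells. -/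
abbrev BoxOf (K : Finset Cell) : Type := {c : Cell // c ∈ K}

/-- Tableaux of shape `K` with entries in `Fin n` (representing `{1, …, n}`). -/
abbrev Tab (K : Finset Cell) (n : ℕ) : Type := BoxOf K → Fin n

/-- `ℱ_{K,n}`: the free complex vector space on the set of tableaux of shape `K`. -/
abbrev FreeT (K : Finset Cell) (n : ℕ) : Type := Tab K n →₀ ℂ

/-- The number of boxes of `K` in row `r` (the width of row `r`). -/
def rowWidth (K : Finset Cell) (r : ℕ) : ℕ := (K.filter fun c => c.1 = r).card

/-- The set of indices of nonempty rows of `K`. -/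
def rowsOf (K : Finset Cell) : Finset ℕ := K.image Prod.fst

/-- The set of boxes of `K` lying in row `r`. -/
def rowBoxes (K : Finset Cell) (r : ℕ) : Finset (BoxOf K) :=
  Finset.univ.filter fun b => b.val.1 = r

/-- Action of a permutation of the boxes on tableaux: `(σ · T) x = T (σ⁻¹ x)`. -/
def permAct {K : Finset Cell} {n : ℕ} (σ : Equiv.Perm (BoxOf K)) (T : Tab K n) : Tab K n :=
  fun x => T (σ⁻¹ x)

/-- The linear extension of the permutation action to `ℱ_{K,n}`. -/
def permL (K : Finset Cell) (n : ℕ) (σ : Equiv.Perm (BoxOf K)) : FreeT K n →ₗ[ℂ] FreeT K n :=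
  Finsupp.lift (FreeT K n) ℂ (Tab K n) fun T => Finsupp.single (permAct σ T) 1

/-- `w_A`: the maximum width of a row meeting `A`. -/
def wA (K : Finset Cell) (A : Finset (BoxOf K)) : ℕ := A.sup fun x => rowWidth K x.val.1

/-- `𝔖_A`: permutations preserving `A` and fixing every box outside `A`. -/
def SA {K : Finset Cell} (A : Finset (BoxOf K)) : Finset (Equiv.Perm (BoxOf K)) :=
  Finset.univ.filter fun σ => ∀ x, x ∉ A → σ x = x

/-- The Garnir operator `G_A` applied to a tableau `T`. -/
def garnir {K : Finset Cell} {n : ℕ} (A : Finset (BoxOf K)) (T : Tab K n) : FreeT K n :=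
  ∑ σ ∈ SA A, Finsupp.single (permAct σ T) 1

/-- The linear extension of the Garnir operator `G_A` to `ℱ_{K,n}`. -/
def garnirL (K : Finset Cell) (n : ℕ) (A : Finset (BoxOf K)) : FreeT K n →ₗ[ℂ] FreeT K n :=
  Finsupp.lift (FreeT K n) ℂ (Tab K n) fun T => garnir A T

/-- Two tableaux agree up to permutations of the entries within rows. -/
def RowEquiv {K : Finset Cell} {n : ℕ} (T₁ T₂ : Tab K n) : Prop :=
  ∃ σ : Equiv.Perm (BoxOf K), (∀ x, (σ x).val.1 = x.val.1) ∧ T₂ = permAct σ T₁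

/-- The span of the row-permutation differences `T₁ - T₂`. -/
def rowSpan (K : Finset Cell) (n : ℕ) : Submodule ℂ (FreeT K n) :=
  Submodule.span ℂ
    {z | ∃ T₁ T₂ : Tab K n, RowEquiv T₁ T₂ ∧ z = Finsupp.single T₁ 1 - Finsupp.single T₂ 1}

/-- `R_{K,n}`: the subspace of relations, spanned by row-permutation differences and
Garnir elements `G_A T` for `|A| > w_A`. -/
def Rmod (K : Finset Cell) (n : ℕ) : Submodule ℂ (FreeT K n) :=
  Submodule.span ℂ
    ({z | ∃ T₁ T₂ : Tab K n, RowEquiv T₁ T₂ ∧ z = Finsupp.single T₁ 1 - Finsupp.single T₂ 1} ∪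
      {z | ∃ (A : Finset (BoxOf K)) (T : Tab K n), wA K A < A.card ∧ z = garnir A T})

/-- The standard basis vector `e_i` of `V = ℂⁿ`. -/
def stdv (n : ℕ) (i : Fin n) : Fin n → ℂ := Pi.single i 1

/-- The action of a matrix `g` on `ℱ_{K,n}`:
`g · T = ∑_{T'} (∏_x g_{T'(x), T(x)}) T'`. -/
def glAct (K : Finset Cell) (n : ℕ) (g : Matrix (Fin n) (Fin n) ℂ) :
    FreeT K n →ₗ[ℂ] FreeT K n :=
  Finsupp.lift (FreeT K n) ℂ (Tab K n) fun T =>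
    ∑ T' : Tab K n, (∏ x : BoxOf K, g (T' x) (T x)) • Finsupp.single T' (1 : ℂ)

/-! ### Removal sets -/

/-- A removal set of `m` boxes `x_1 < x_2 < ⋯ < x_m` for the shape `K`: each `x_k` is the
rightmost box of its row, `x_1` is geometrically lowest (largest top-row-index), … , `x_m`
highest, and removing all of them leaves a Young-diagram shape (a lower set). -/
structure RemovalOn (K : Finset Cell) (m : ℕ) where
  box : Fin m → Cell
  mem : ∀ k, box k ∈ K
  lastCol : ∀ k, (box k).2 + 1 = rowWidth K (box k).1
  rows_anti : StrictAnti fun k => (box k).1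
  lower : IsLowerSet (↑(K.filter fun c => ∀ i : Fin m, (i : ℕ) < m → c ≠ box i) : Set Cell)

/-- The shape obtained from `K` by removing the first `k` boxes `x_1, …, x_k` of `X`. -/
def keptUpTo {K : Finset Cell} {m : ℕ} (X : RemovalOn K m) (k : ℕ) : Finset Cell :=
  K.filter fun c => ∀ i : Fin m, (i : ℕ) < k → c ≠ X.box i

/-- `λ ∖ X`: the shape obtained by removing all the boxes of `X`. -/
abbrev RemovalOn.kept {K : Finset Cell} {m : ℕ} (X : RemovalOn K m) : Finset Cell := keptUpTo X m

lemma keptUpTo_subset {K : Finset Cell} {m : ℕ} (X : RemovalOn K m) (k : ℕ) :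
    keptUpTo X k ⊆ K := Finset.filter_subset _ _

lemma kept_subset {K : Finset Cell} {m : ℕ} (X : RemovalOn K m) : X.kept ⊆ K :=
  Finset.filter_subset _ _

lemma keptUpTo_zero {K : Finset Cell} {m : ℕ} (X : RemovalOn K m) : K = keptUpTo X 0 :=
  (Finset.filter_true_of_mem fun _ _ => fun _ hi => absurd hi (Nat.not_lt_zero _)).symm

/-! ### Paths -/

/-- The boxes of `K` together with `m` extra boxes `y_1, …, y_m` attached above the shape. -/
abbrev PB (K : Finset Cell) (m : ℕ) : Type := BoxOf K ⊕ Fin m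

/-- Comparison value of a box: a box is geometrically weakly lower than another iff its
`lowVal` is larger.  The extra boxes `y_1, y_2, …` get values `-1, -2, …` (above the shape,
with `y_{i+1}` above `y_i`). -/
def lowVal {K : Finset Cell} {m : ℕ} : PB K m → ℤ
  | Sum.inl b => (b.val.1 : ℤ)
  | Sum.inr i => -1 - (i : ℤ)

/-- An evacuation route starting at the block whose bottom row is `r₁`: it contains a box in
row `r₁`, at most one box per row, and skips no row within a block (blocks being the groups
of rows of equal width). -/
structure IsEvacRoute (K : Finset Cell) (r₁ : ℕ) (R : Finset (BoxOf K)) : Prop where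
  start : ∃ b ∈ R, b.val.1 = r₁
  one_per_row : ∀ b ∈ R, ∀ b' ∈ R, b.val.1 = b'.val.1 → b = b'
  no_skip : ∀ b ∈ R, ∀ r' : ℕ, b.val.1 < r' → rowWidth K r' = rowWidth K b.val.1 →
    ∃ b' ∈ R, b'.val.1 = r'

/-- The orbit `R_i` of `x_i` under iteration of `P`. -/
def orb {K : Finset Cell} {m : ℕ} (X : RemovalOn K m) (P : PB K m → PB K m) (i : Fin m) :
    Set (PB K m) := {z | ∃ j : ℕ, P^[j] (Sum.inl ⟨X.box i, X.mem i⟩) = z}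

/-- The orbit of `x_i` meets the block (of the original shape) of width `w`. -/
def meetsBlock {K : Finset Cell} {m : ℕ} (X : RemovalOn K m) (P : PB K m → PB K m)
    (i : Fin m) (w : ℕ) : Prop :=
  ∃ c : BoxOf K, Sum.inl c ∈ orb X P i ∧ rowWidth K c.val.1 = w

/-- `P` together with the evacuation route `R` is an `m`-path removing `X`:
see Section 4.2 of the paper. -/
structure IsMPath {K : Finset Cell} {m : ℕ} [NeZero m] (X : RemovalOn K m)
    (P : PB K m → PB K m) (R : Finset (BoxOf K)) : Prop where
  /-- the route starts at the block of `x₁` -/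
  route : IsEvacRoute K (X.box 0).1 R
  /-- `P` is geometrically (weakly) increasing -/
  mono : ∀ z, lowVal (P z) ≤ lowVal z
  /-- and strictly increasing on the route -/
  strict_on_route : ∀ b ∈ R, lowVal (P (Sum.inl b)) < (b.val.1 : ℤ)
  /-- `y_i` belongs to the orbit of `x_i` -/
  y_mem : ∀ i, Sum.inr i ∈ orb X P i
  /-- `R ∪ X ∪ Y` is the union of the orbits -/
  orb_union : (⋃ i, orb X P i) =
    {z : PB K m | (∃ b ∈ R, z = Sum.inl b) ∨ (∃ i, z = Sum.inl ⟨X.box i, X.mem i⟩) ∨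
      ∃ i, z = Sum.inr i}
  /-- and the union is disjoint -/
  orb_disjoint : ∀ i j, i ≠ j → Disjoint (orb X P i) (orb X P j)
  /-- if `k` distinct orbits meet a block, then (up to relabeling) the `j`-th of them meets
  the `j`-th row from the bottom of the block, for `j = 0, …, k-1` -/
  interlace : ∀ w : ℕ, 0 < w → ∃ g : Fin m → ℕ,
    Set.InjOn g {i | meetsBlock X P i w} ∧
    ∀ i, meetsBlock X P i w →
      g i < Set.ncard {j | meetsBlock X P j w} ∧
      ∃ c : BoxOf K, Sum.inl c ∈ orb X P i ∧ rowWidth K c.val.1 = w ∧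
        ((rowsOf K).filter fun r => c.val.1 < r ∧ rowWidth K r = w).card = g i
  /-- `P` preserves row order within blocks on the route -/
  row_order : ∀ b ∈ R, ∀ b' ∈ R, ∀ c c' : BoxOf K,
    rowWidth K b.val.1 = rowWidth K b'.val.1 → b'.val.1 < b.val.1 →
    P (Sum.inl b) = Sum.inl c → P (Sum.inl b') = Sum.inl c' →
    rowWidth K c.val.1 = rowWidth K b.val.1 → rowWidth K c'.val.1 = rowWidth K b.val.1 →
    c'.val.1 < c.val.1
  /-- `P` fixes the extra boxes -/
  fix_y : ∀ i, P (Sum.inr i) = Sum.inr i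
  /-- `P` fixes every box outside `R ∪ X` -/
  fix_out : ∀ b : BoxOf K, b ∉ R → (∀ i, b.val ≠ X.box i) → P (Sum.inl b) = Sum.inl b
  /-- `P(R ∪ X) = (R ∖ X) ∪ Y` -/
  image_route : (fun b : BoxOf K => P (Sum.inl b)) ''
      {b : BoxOf K | b ∈ R ∨ ∃ i, b.val = X.box i} =
    (Sum.inl '' {b : BoxOf K | b ∈ R ∧ ∀ i, b.val ≠ X.box i}) ∪
      Set.range (Sum.inr : Fin m → PB K m)

/-- The type of `m`-paths removing `X` (a path is the pair of the map and its route). -/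
def MPath {K : Finset Cell} {m : ℕ} [NeZero m] (X : RemovalOn K m) : Type :=
  {PR : (PB K m → PB K m) × Finset (BoxOf K) // IsMPath X PR.1 PR.2}

instance {K : Finset Cell} {m : ℕ} [NeZero m] (X : RemovalOn K m) : Fintype (MPath X) := by
  unfold MPath; infer_instance

/-- The underlying map of boxes of a path. -/
def MPath.map {K : Finset Cell} {m : ℕ} [NeZero m] {X : RemovalOn K m} (P : MPath X) :
    PB K m → PB K m := P.val.1

/-- The evacuation route of a path. -/
def MPath.route {K : Finset Cell} {m : ℕ} [NeZero m] {X : RemovalOn K m} (P : MPath X) :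
    Finset (BoxOf K) := P.val.2

/-- `P⁻¹ z`: the (unique) box of the original shape whose image under `P` is `z`. -/
def pinv {K : Finset Cell} {m : ℕ} [NeZero m] (X : RemovalOn K m) (P : PB K m → PB K m)
    (z : PB K m) : BoxOf K :=
  @Function.invFun (BoxOf K) (PB K m) ⟨⟨X.box 0, X.mem 0⟩⟩ (fun b => P (Sum.inl b)) z

/-- `α_i^P`: the entry of `T` in the box `P⁻¹ (y_i)`. -/
def alphaP {K : Finset Cell} {m n : ℕ} [NeZero m] (X : RemovalOn K m) (T : Tab K n)
    (P : PB K m → PB K m) (i : Fin m) : Fin n := T (pinv X P (Sum.inr i))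

/-- `T_P`: the tableau of shape `λ ∖ X` with `(T_P)_z = T_{P⁻¹ z}`. -/
def TP {K : Finset Cell} {m n : ℕ} [NeZero m] (X : RemovalOn K m) (T : Tab K n)
    (P : PB K m → PB K m) : Tab X.kept n :=
  fun z => T (pinv X P (Sum.inl ⟨z.val, kept_subset X z.2⟩))

/-! ### Hook lengths and coefficients -/

/-- `H(b)` for the block `b` of width `w`, relative to the starting row `r₁`:
`H(b) = (w_b - w_{b₁}) + (number of rows in blocks b₁, …, b-1)`. -/
def HW (K : Finset Cell) (r₁ w : ℕ) : ℤ :=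
  ((w : ℤ) - (rowWidth K r₁ : ℤ)) +
    (((rowsOf K).filter fun ρ => rowWidth K r₁ ≤ rowWidth K ρ ∧ rowWidth K ρ < w).card : ℤ)

/-- `H(P)` for a `1`-path with route `R`: the product of `H(b)` over the blocks `b > b₁`
met by the route. -/
def HP1 (K : Finset Cell) (r₁ : ℕ) (R : Finset (BoxOf K)) : ℤ :=
  ∏ w ∈ (R.image fun b => rowWidth K b.val.1).filter (fun w => rowWidth K r₁ < w), HW K r₁ w

/-- The rank (from the bottom, `1`-based) of a route box among the route boxes lying in the
same block. -/
def rankIn (K : Finset Cell) (R : Finset (BoxOf K)) (b : BoxOf K) : ℕ :=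
  (R.filter fun b' => rowWidth K b'.val.1 = rowWidth K b.val.1 ∧ b.val.1 ≤ b'.val.1).card

/-- `H(P)` for an `m`-path with route `R`:
`H(P) = ∏_{b > b₁ met by R} ∏_{i=1}^{k_b} (H(b) - (m - i))`. -/
def HPm (K : Finset Cell) (m : ℕ) (r₁ : ℕ) (R : Finset (BoxOf K)) : ℤ :=
  ∏ b ∈ R.filter fun b => rowWidth K r₁ < rowWidth K b.val.1,
    (HW K r₁ (rowWidth K b.val.1) - (m : ℤ) + (rankIn K R b : ℤ))

/-- The coefficient `(-1)^P / H(P)` of a `1`-path. -/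
def coeff1 (K : Finset Cell) (r₁ : ℕ) (R : Finset (BoxOf K)) : ℂ :=
  (-1 : ℂ) ^ R.card / ((HP1 K r₁ R : ℤ) : ℂ)

/-- The coefficient `(-1)^P / H(P)` of an `m`-path. -/
def coeffm (K : Finset Cell) (m r₁ : ℕ) (R : Finset (BoxOf K)) : ℂ :=
  (-1 : ℂ) ^ R.card / ((HPm K m r₁ R : ℤ) : ℂ)

/-- The subspace `W ⊗ R_{K,n}` of `W ⊗ ℱ_{K,n}`. -/
def tensR (W : Type) [AddCommGroup W] [Module ℂ W] (K : Finset Cell) (n : ℕ) :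
    Submodule ℂ (W ⊗[ℂ] FreeT K n) :=
  Submodule.span ℂ {z | ∃ (a : W) (r : FreeT K n), r ∈ Rmod K n ∧ z = a ⊗ₜ[ℂ] r}

/-! ### Path extensions -/

/-- `B` is a `(ρ, ρ')`-route extension of `R`, where `ρ` is the (geometrically lower) row
with top-index `rlow` and `ρ'` the (higher) row with top-index `rhigh ≤ rlow`: the two
routes agree strictly below `ρ` and strictly above `ρ'`. -/
def RouteExt {K : Finset Cell} (rlow rhigh : ℕ) (R B : Finset (BoxOf K)) : Prop :=
  R.filter (fun b => rlow < b.val.1) = B.filter (fun b => rlow < b.val.1) ∧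
  R.filter (fun b => b.val.1 < rhigh) = B.filter (fun b => b.val.1 < rhigh)

/-- `Q` is a `(ρ, ρ')`-path extension of `P` (rows as in `RouteExt`). -/
def PathExt {K : Finset Cell} {m : ℕ} [NeZero m] {X : RemovalOn K m} (rlow rhigh : ℕ)
    (P Q : MPath X) : Prop :=
  RouteExt rlow rhigh P.route Q.route ∧
  (∀ b ∈ P.route, b.val.1 < rhigh → Q.map (Sum.inl b) = P.map (Sum.inl b)) ∧
  (∀ b ∈ P.route, rlow < b.val.1 →
    ¬(∃ c : BoxOf K, P.map (Sum.inl b) = Sum.inl c ∧ rhigh ≤ c.val.1 ∧ c.val.1 ≤ rlow) →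
    Q.map (Sum.inl b) = P.map (Sum.inl b))

/-! ### The Pieri inclusion removing one box -/

/-- `P(T) = e_{α₁^P} ⊗ T_P` for a `1`-path. -/
def pact1 {K : Finset Cell} {n : ℕ} (X : RemovalOn K 1) (T : Tab K n)
    (P : PB K 1 → PB K 1) : (Fin n → ℂ) ⊗[ℂ] FreeT X.kept n :=
  stdv n (alphaP X T P 0) ⊗ₜ[ℂ] Finsupp.single (TP X T P) 1

/-- The Pieri inclusion `Φ₁ : ℱ_{λ,n} → V ⊗ ℱ_{λ∖X,n}`,
`Φ₁ T = ∑_P ((-1)^P / H(P)) P(T)`, the sum over all `1`-paths removing `X`. -/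
def Phi1 {K : Finset Cell} (X : RemovalOn K 1) (n : ℕ) :
    FreeT K n →ₗ[ℂ] ((Fin n → ℂ) ⊗[ℂ] FreeT X.kept n) :=
  Finsupp.lift ((Fin n → ℂ) ⊗[ℂ] FreeT X.kept n) ℂ (Tab K n) fun T =>
    ∑ P : MPath X, coeff1 K (X.box 0).1 P.route • pact1 X T P.map

/-! ### The Pieri inclusion removing `m` boxes -/

/-- The exterior algebra of `V = ℂⁿ`; `Λ^m V` sits inside it as the span of the products of
`m` generators. -/
abbrev ExtV (n : ℕ) := ExteriorAlgebra ℂ (Fin n → ℂ)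

/-- `e_{α₁} ∧ ⋯ ∧ e_{α_m}`. -/
def wedgeOf {n m : ℕ} (v : Fin m → Fin n) : ExtV n :=
  (List.ofFn fun i => ExteriorAlgebra.ι ℂ (stdv n (v i))).prod

/-- `P(T) = (e_{α₁^P} ∧ ⋯ ∧ e_{α_m^P}) ⊗ T_P` for an `m`-path. -/
def pactm {K : Finset Cell} {m n : ℕ} [NeZero m] (X : RemovalOn K m) (T : Tab K n)
    (P : PB K m → PB K m) : ExtV n ⊗[ℂ] FreeT X.kept n :=
  wedgeOf (alphaP X T P) ⊗ₜ[ℂ] Finsupp.single (TP X T P) 1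

/-- The Pieri inclusion `Φ_m : ℱ_{λ,n} → Λ^m V ⊗ ℱ_{λ∖X,n}`,
`Φ_m T = ∑_P ((-1)^P / H(P)) P(T)`, the sum over all `m`-paths removing `X`. -/
def Phim {K : Finset Cell} {m : ℕ} [NeZero m] (X : RemovalOn K m) (n : ℕ) :
    FreeT K n →ₗ[ℂ] (ExtV n ⊗[ℂ] FreeT X.kept n) :=
  Finsupp.lift (ExtV n ⊗[ℂ] FreeT X.kept n) ℂ (Tab K n) fun T =>
    ∑ P : MPath X, coeffm K m (X.box 0).1 P.route • pactm X T P.map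

/-- The functorial action of a matrix `g` on the exterior algebra of `V`. -/
def extMap (n : ℕ) (g : Matrix (Fin n) (Fin n) ℂ) : ExtV n →ₐ[ℂ] ExtV n :=
  ExteriorAlgebra.lift ℂ
    ⟨(ExteriorAlgebra.ι ℂ).comp (Matrix.mulVecLin g), fun _ => ExteriorAlgebra.ι_sq_zero _⟩

/-! ### The iterated one-box removal map -/

/-- Transport of `ℱ` along an equality of shapes. -/
def castF {K₁ K₂ : Finset Cell} {n : ℕ} (h : K₁ = K₂) : FreeT K₁ n ≃ₗ[ℂ] FreeT K₂ n := by
  subst h; exact LinearEquiv.refl ℂ _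

/-- `a ⊗ v ↦ a ∧ v` (wedging a new vector on after the previous ones). -/
def wedgeStep (n : ℕ) : (ExtV n ⊗[ℂ] (Fin n → ℂ)) →ₗ[ℂ] ExtV n :=
  TensorProduct.lift ((LinearMap.mul ℂ (ExtV n)).compl₂ (ExteriorAlgebra.ι ℂ))

/-- The iterated one-box removal map `Φ₁^k : ℱ_{λ,n} → Λ^k V ⊗ ℱ_{λ∖{x₁,…,x_k},n}`:
`Φ₁^0 = 1 ⊗ id`, and `Φ₁^{k+1}` is obtained from `Φ₁^k` by applying the one-box removal
map `Φ₁` of `x_{k+1}` (on the shape `λ∖{x₁,…,x_k}`) to the second factor and wedging the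
newly removed basis vector on after the previously removed ones.
Here `Xstep k` is the one-box removal datum of `x_{k+1}` on `λ∖{x₁,…,x_k}`. -/
def PhiIter {K : Finset Cell} {m : ℕ} (X : RemovalOn K m)
    (Xstep : ∀ k : Fin m, RemovalOn (keptUpTo X (k : ℕ)) 1)
    (hkept : ∀ k : Fin m, (Xstep k).kept = keptUpTo X ((k : ℕ) + 1)) (n : ℕ) :
    ∀ k : ℕ, k ≤ m → (FreeT K n →ₗ[ℂ] (ExtV n ⊗[ℂ] FreeT (keptUpTo X k) n))
  | 0, _ =>
    (TensorProduct.mk ℂ (ExtV n) (FreeT (keptUpTo X 0) n) 1).comp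
      (castF (keptUpTo_zero X)).toLinearMap
  | k + 1, h =>
    (TensorProduct.map (wedgeStep n) LinearMap.id).comp
      ((TensorProduct.assoc ℂ (ExtV n) (Fin n → ℂ)
          (FreeT (keptUpTo X (k + 1)) n)).symm.toLinearMap.comp
        ((TensorProduct.map (LinearMap.id : ExtV n →ₗ[ℂ] ExtV n)
            ((TensorProduct.map LinearMap.id (castF (hkept ⟨k, h⟩)).toLinearMap).comp
              (Phi1 (Xstep ⟨k, h⟩) n))).comp
          (PhiIter X Xstep hkept n k (Nat.le_of_succ_le h))))

/-! ### Chains of polarization operators -/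

section Chains

variable {M : Type*} [AddCommGroup M] [Module ℂ M]

/-- Operators `E i j` and `D i` satisfying the commutation relations of the polarization
operators `∑ₐ z_{i,a} ∂_{j,a}` and of the partial derivatives `∂_{i,a}` (for fixed `a`). -/
structure PolarizationRel (E : ℕ → ℕ → Module.End ℂ M) (D : ℕ → Module.End ℂ M) : Prop where
  comm : ∀ i j k l x, E i j (E k l x) =
    E k l (E i j x) + (if j = k then E i l x else 0) - (if l = i then E k j x else 0)
  commD : ∀ s i j x, D s (E i j x) = E i j (D s x) + if s = i then D j x else 0

/-- The simultaneous eigenspace of the operators `E i i` with eigenvalues `ν i`. -/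
def wtSpace (E : ℕ → ℕ → Module.End ℂ M) (ν : ℕ → ℂ) : Submodule ℂ M where
  carrier := {x | ∀ i, E i i x = ν i • x}
  add_mem' {x y} hx hy i := by
    rw [map_add, hx i, hy i, smul_add]
  zero_mem' i := by simp
  smul_mem' c x hx i := by
    rw [map_smul, hx i, smul_comm]

/-- The indicator of `i`, as a weight. -/
def eps (i : ℕ) : ℕ → ℂ := Pi.single i 1

/-- The weighted sum over all chains of rows that start at `s` and go up, of the
corresponding products of operators. -/
def chain (E : ℕ → ℕ → Module.End ℂ M) (D : ℕ → Module.End ℂ M) (κ : ℕ → ℕ → ℂ) :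
    ℕ → Module.End ℂ M
  | s => D s - ∑ t : Fin s, κ s t • (E t s * chain E D κ t)

variable {E : ℕ → ℕ → Module.End ℂ M} {D : ℕ → Module.End ℂ M}

lemma chain_apply (κ : ℕ → ℕ → ℂ) (s : ℕ) (x : M) :
    chain E D κ s x =
      D s x - ∑ t ∈ Finset.range s, κ s t • E t s (chain E D κ t x) := by
  rw [chain, Finset.sum_range]
  simp [LinearMap.sum_apply]

lemma chain_zero (κ : ℕ → ℕ → ℂ) (x : M) : chain E D κ 0 x = D 0 x := by
  rw [chain_apply, Finset.sum_range_zero, sub_zero]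

lemma PolarizationRel.wt_E (h : PolarizationRel E D) {ν : ℕ → ℂ} {x : M}
    (hx : x ∈ wtSpace E ν) (i j : ℕ) : E i j x ∈ wtSpace E (ν + eps i - eps j) := by
  intro k
  rw [h.comm k k i j x, hx k]
  by_cases h1 : k = i <;> by_cases h2 : j = k <;>
    simp [eps, Pi.single_apply, h1, h2, add_smul, sub_smul]
  all_goals grind

lemma PolarizationRel.wt_D (h : PolarizationRel E D) {ν : ℕ → ℂ} {x : M}
    (hx : x ∈ wtSpace E ν) (s : ℕ) : D s x ∈ wtSpace E (ν - eps s) := by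
  intro k
  have := h.commD s k k x
  rw [hx k, map_smul] at this
  by_cases h1 : s = k
  · subst h1
    simp only [if_true] at this
    simp only [eps, Pi.sub_apply, Pi.single_eq_same, sub_smul, one_smul, this]
    abel
  · simp only [h1, if_false, add_zero] at this
    simp [eps, Ne.symm h1, this]

lemma PolarizationRel.wt_chain (h : PolarizationRel E D) {ν : ℕ → ℂ} {x : M}
    (hx : x ∈ wtSpace E ν) (κ : ℕ → ℕ → ℂ) (s : ℕ) :
    chain E D κ s x ∈ wtSpace E (ν - eps s) := by
  induction s using Nat.strong_induction_on with
  | _ s ih =>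
    rw [chain_apply]
    refine Submodule.sub_mem _ (h.wt_D hx s) (Submodule.sum_mem _ fun t ht => ?_)
    refine Submodule.smul_mem _ _ ?_
    have := h.wt_E (ih t (Finset.mem_range.1 ht)) t s
    rwa [show ν - eps t + eps t - eps s = ν - eps s by abel] at this

/-! #### Commutation of the full chain sum with lowering operators -/

/-- The coefficients of the chain sum over all chains of rows. -/
def fullCoeff (H : ℕ → ℂ) : ℕ → ℕ → ℂ := fun _ t => (H t)⁻¹

lemma PolarizationRel.chain_comm_of_le (h : PolarizationRel E D) (κ : ℕ → ℕ → ℂ) (p : ℕ)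
    (x : M) (s : ℕ) (hs : s ≤ p) :
    chain E D κ s (E (p + 1) p x) = E (p + 1) p (chain E D κ s x) := by
  induction s using Nat.strong_induction_on with
  | _ s ih =>
    rw [chain_apply, chain_apply, map_sub, map_sum, h.commD, if_neg (by omega), add_zero]
    congr 1
    refine Finset.sum_congr rfl fun t ht => ?_
    have ht := Finset.mem_range.1 ht
    rw [ih t ht (by omega), h.comm t s, if_neg (by omega), if_neg (by omega)]
    simp

lemma PolarizationRel.fullChain_comm_succ (h : PolarizationRel E D) (H lam : ℕ → ℂ) (p : ℕ)
    (hH : H p = H (p + 1) + lam p - lam (p + 1) + 1) (h0 : H p ≠ 0) {x : M}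
    (hx : x ∈ wtSpace E (lam + eps p - eps (p + 1))) :
    chain E D (fullCoeff H) (p + 1) (E (p + 1) p x) =
      E (p + 1) p (chain E D (fullCoeff H) (p + 1) x) +
        (H (p + 1) / H p) • chain E D (fullCoeff H) p x := by
  have hw := h.wt_chain hx (fullCoeff H) p
  have h1 : E p (p + 1) (E (p + 1) p (chain E D (fullCoeff H) p x)) =
      E (p + 1) p (E p (p + 1) (chain E D (fullCoeff H) p x)) +
        (lam p - lam (p + 1) + 1) • chain E D (fullCoeff H) p x := by
    rw [h.comm p (p + 1) (p + 1) p, if_pos rfl, if_pos rfl, hw p, hw (p + 1)]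
    simp only [eps, Pi.sub_apply, Pi.add_apply, Pi.single_apply, if_true]
    simp only [Nat.left_eq_add, one_ne_zero, if_false, Nat.add_eq_left]
    module
  have h2 : ∀ t ∈ Finset.range p, fullCoeff H (p + 1) t •
      E t (p + 1) (chain E D (fullCoeff H) t (E (p + 1) p x)) =
      E (p + 1) p (fullCoeff H (p + 1) t • E t (p + 1) (chain E D (fullCoeff H) t x)) +
        fullCoeff H p t • E t p (chain E D (fullCoeff H) t x) := by
    intro t ht
    have ht := Finset.mem_range.1 ht
    rw [h.chain_comm_of_le _ _ _ _ ht.le, h.comm t (p + 1), if_pos rfl, if_neg (by omega)]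
    simp [fullCoeff, smul_add]
  have h3 := chain_apply (E := E) (D := D) (fullCoeff H) p x
  rw [chain_apply, chain_apply (s := p + 1) (x := x), h.commD, if_pos rfl,
    Finset.sum_range_succ, Finset.sum_range_succ, Finset.sum_congr rfl h2,
    h.chain_comm_of_le _ _ _ _ le_rfl, h1, Finset.sum_add_distrib, map_sub, map_add,
    map_sum]
  rw [eq_sub_iff_add_eq] at h3
  rw [← h3]
  have h4 : H (p + 1) / H p = 1 - (H p)⁻¹ * (lam p - lam (p + 1) + 1) := by
    field_simp
    rw [hH]; ring
  rw [h4, map_smul]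
  simp only [fullCoeff]
  module

lemma PolarizationRel.fullChain_comm (h : PolarizationRel E D) (H lam : ℕ → ℂ) (r p : ℕ)
    (hH : ∀ q, H q = H (q + 1) + lam q - lam (q + 1) + 1) (h0 : ∀ t < r, H t ≠ 0)
    (hr : H r = 0) {x : M} (hx : x ∈ wtSpace E (lam + eps p - eps (p + 1))) :
    chain E D (fullCoeff H) r (E (p + 1) p x) =
      E (p + 1) p (chain E D (fullCoeff H) r x) := by
  rcases le_or_gt r p with hrp | hrp
  · exact h.chain_comm_of_le _ _ _ _ hrp
  have key := h.fullChain_comm_succ H lam p (hH p) (h0 p hrp) hx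
  rcases Nat.eq_or_lt_of_le (Nat.succ_le_of_lt hrp) with e | hlt
  · have e : p + 1 = r := e
    subst e
    rw [key, hr]; simp
  have hp1 : H (p + 1) ≠ 0 := h0 _ hlt
  have hp0 : H p ≠ 0 := h0 _ hrp
  suffices ∀ s, p + 1 < s → chain E D (fullCoeff H) s (E (p + 1) p x) =
      E (p + 1) p (chain E D (fullCoeff H) s x) from this r hlt
  intro s
  induction s using Nat.strong_induction_on with
  | _ s ih =>
    intro hs
    obtain ⟨d, rfl⟩ : ∃ d, s = p + 1 + 1 + d := ⟨s - (p + 1 + 1), by omega⟩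
    have hlow : ∀ t ∈ Finset.range p, fullCoeff H (p + 1 + 1 + d) t •
        E t (p + 1 + 1 + d) (chain E D (fullCoeff H) t (E (p + 1) p x)) =
        E (p + 1) p (fullCoeff H (p + 1 + 1 + d) t •
          E t (p + 1 + 1 + d) (chain E D (fullCoeff H) t x)) := by
      intro t ht
      have ht := Finset.mem_range.1 ht
      rw [h.chain_comm_of_le _ _ _ _ ht.le, h.comm t, if_neg (by omega), if_neg (by omega)]
      simp
    have hhigh : ∀ t ∈ Finset.range d, fullCoeff H (p + 1 + 1 + d) (p + 1 + 1 + t) •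
        E (p + 1 + 1 + t) (p + 1 + 1 + d)
          (chain E D (fullCoeff H) (p + 1 + 1 + t) (E (p + 1) p x)) =
        E (p + 1) p (fullCoeff H (p + 1 + 1 + d) (p + 1 + 1 + t) •
          E (p + 1 + 1 + t) (p + 1 + 1 + d) (chain E D (fullCoeff H) (p + 1 + 1 + t) x)) := by
      intro t ht
      have ht := Finset.mem_range.1 ht
      rw [ih _ (by omega) (by omega), h.comm (p + 1 + 1 + t), if_neg (by omega),
        if_neg (by omega)]
      simp
    have hsplit : ∀ f : ℕ → M, ∑ t ∈ Finset.range (p + 1 + 1 + d), f t =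
        ∑ t ∈ Finset.range p, f t + f p + f (p + 1) +
          ∑ t ∈ Finset.range d, f (p + 1 + 1 + t) := fun f => by
      rw [Finset.sum_range_add, Finset.sum_range_succ, Finset.sum_range_succ]
    rw [chain_apply, chain_apply (x := x), h.commD, if_neg (by omega),
      hsplit, hsplit, Finset.sum_congr rfl hhigh, Finset.sum_congr rfl hlow, key,
      h.chain_comm_of_le _ _ _ _ le_rfl, h.comm p, if_neg (by omega), if_pos rfl,
      map_add (E (p + 1) _), h.comm (p + 1) _ (p + 1) p, if_neg (by omega), if_neg (by omega)]
    simp only [fullCoeff, map_smul, map_add, map_sub, map_sum, smul_add, smul_sub, smul_smul]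
    rw [show (H (p + 1))⁻¹ * (H (p + 1) / H p) = (H p)⁻¹ by field_simp]
    module

/-! #### Comparison with the chain sum over bottom segments of blocks -/

/-- The coefficients of the chain sum over those chains of rows which meet every block (group
of rows with equal `lam`) in a bottom segment. -/
def blockCoeff (H lam : ℕ → ℂ) : ℕ → ℕ → ℂ := fun s t =>
  if lam (t + 1) ≠ lam t then (H t)⁻¹ else if t + 1 = s then 1 else 0

/-- Images of the operators `E u t` that move an entry up within a block lying above row `s`. -/
def blockMoves (E : ℕ → ℕ → Module.End ℂ M) (lam : ℕ → ℂ) (s : ℕ) : Submodule ℂ M :=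
  Submodule.span ℂ {w | ∃ u t x, u < t ∧ t < s ∧ lam u = lam t ∧
    x ∈ wtSpace E (lam - eps s + eps t - eps u) ∧ w = E u t x}

lemma PolarizationRel.blockMoves_map (h : PolarizationRel E D) (lam : ℕ → ℂ) {t s : ℕ}
    (hts : t < s) {w : M} (hw : w ∈ blockMoves E lam t) : E t s w ∈ blockMoves E lam s := by
  induction hw using Submodule.span_induction with
  | mem w hw =>
    obtain ⟨u, v, x, huv, hvt, hl, hx, rfl⟩ := hw
    refine Submodule.subset_span ⟨u, v, E t s x, huv, by omega, hl, ?_, ?_⟩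
    · have := h.wt_E hx t s
      rwa [show lam - eps t + eps v - eps u + eps t - eps s = lam - eps s + eps v - eps u by
        abel] at this
    · rw [h.comm t s, if_neg (by omega), if_neg (by omega)]
      simp
  | zero => simp
  | add x y _ _ hx hy => rw [map_add]; exact Submodule.add_mem _ hx hy
  | smul c x _ hx => rw [map_smul]; exact Submodule.smul_mem _ _ hx

/-- The part of the block chain sum at row `s` whose second row is `t` or the bottom row of a
block above `t`, with the coefficient `(H t)⁻¹` at `t`. -/
def blockSum (E : ℕ → ℕ → Module.End ℂ M) (D : ℕ → Module.End ℂ M) (H lam : ℕ → ℂ)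
    (t s : ℕ) (x : M) : M :=
  (H t)⁻¹ • E t s (chain E D (blockCoeff H lam) t x) +
    ∑ u ∈ Finset.range t, if lam (u + 1) ≠ lam u then
      (H u)⁻¹ • E u s (chain E D (blockCoeff H lam) u x) else 0

lemma blockChain_succ (H lam : ℕ → ℂ) (u : ℕ) (x : M) :
    chain E D (blockCoeff H lam) (u + 1) x = D (u + 1) x - blockSum E D H lam u (u + 1) x -
      if lam (u + 1) = lam u then
        (1 - (H u)⁻¹) • E u (u + 1) (chain E D (blockCoeff H lam) u x) else 0 := by
  rw [chain_apply, Finset.sum_range_succ, blockSum]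
  have : ∀ t ∈ Finset.range u, blockCoeff H lam (u + 1) t •
      E t (u + 1) (chain E D (blockCoeff H lam) t x) = if lam (t + 1) ≠ lam t then
      (H t)⁻¹ • E t (u + 1) (chain E D (blockCoeff H lam) t x) else 0 := by
    intro t ht
    have ht := Finset.mem_range.1 ht
    have : t ≠ u := by omega
    by_cases hl : lam (t + 1) = lam t <;> simp [blockCoeff, hl, this]
  rw [Finset.sum_congr rfl this]
  by_cases hl : lam (u + 1) = lam u <;> simp [blockCoeff, hl] <;> module

lemma PolarizationRel.fullSum_sub_blockSum (h : PolarizationRel E D) (H lam : ℕ → ℂ) (r : ℕ)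
    (hH : ∀ q, H q = H (q + 1) + lam q - lam (q + 1) + 1) (h0 : ∀ t < r, H t ≠ 0) {x : M}
    (hx : x ∈ wtSpace E lam) (t : ℕ) (htr : t < r) (s : ℕ) (hts : t < s) :
    (∑ u ∈ Finset.range (t + 1), (H u)⁻¹ • E u s (chain E D (fullCoeff H) u x)) -
      blockSum E D H lam t s x ∈ blockMoves E lam s := by
  induction t generalizing s with
  | zero => simp [blockSum, chain_zero]
  | succ u ih =>
    have h1 := ih (by omega) (u + 1) (by omega)
    have h2 := ih (by omega) s (by omega)
    have h3 : chain E D (fullCoeff H) (u + 1) x =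
      D (u + 1) x - ∑ v ∈ Finset.range (u + 1), (H v)⁻¹ •
        E v (u + 1) (chain E D (fullCoeff H) v x) := chain_apply _ _ _
    have h4 := blockChain_succ (E := E) (D := D) H lam u x
    have h5 := h.blockMoves_map lam hts h1
    have h6 : blockSum E D H lam (u + 1) s x =
      (H (u + 1))⁻¹ • E (u + 1) s (chain E D (blockCoeff H lam) (u + 1) x) +
        blockSum E D H lam u s x - if lam (u + 1) = lam u then
          (H u)⁻¹ • E u s (chain E D (blockCoeff H lam) u x) else 0 := by
      rw [blockSum, blockSum, Finset.sum_range_succ]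
      by_cases hl : lam (u + 1) = lam u <;> simp [hl] <;> module
    rw [Finset.sum_range_succ, h6]
    set A := ∑ v ∈ Finset.range (u + 1), (H v)⁻¹ •
      E v (u + 1) (chain E D (fullCoeff H) v x)
    set y := chain E D (blockCoeff H lam) u x with hy
    set z := E u s y
    set q := E u (u + 1) y with hq
    have h7 : E (u + 1) s (chain E D (fullCoeff H) (u + 1) x) =
        E (u + 1) s (chain E D (blockCoeff H lam) (u + 1) x) -
          E (u + 1) s (A - blockSum E D H lam u (u + 1) x) +
          if lam (u + 1) = lam u then (1 - (H u)⁻¹) • E (u + 1) s q else 0 := by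
      rw [h3, h4, ← map_sub]
      by_cases hl : lam (u + 1) = lam u
      · simp only [hl, if_true, map_sub, map_smul]; module
      · simp only [hl, if_false, map_sub, map_zero]; module
    rw [h7]
    by_cases hl : lam (u + 1) = lam u
    · simp only [hl, if_true]
      have h8 : E (u + 1) s q + z ∈ blockMoves E lam s := by
        refine Submodule.subset_span ⟨u, u + 1, E (u + 1) s y, by omega, hts, hl.symm, ?_, ?_⟩
        · have := h.wt_E (h.wt_chain hx (blockCoeff H lam) u) (u + 1) s
          rwa [show lam - eps u + eps (u + 1) - eps s = lam - eps s + eps (u + 1) - eps u by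
            abel] at this
        · rw [hq, h.comm (u + 1) s, if_neg (by omega), if_pos rfl]
          simp [z]
      have hHu : H u = H (u + 1) + 1 := by rw [hH u, hl]; ring
      have hu0 : H u ≠ 0 := h0 u (by omega)
      have hu1 : H (u + 1) ≠ 0 := h0 (u + 1) htr
      have h9 : (H (u + 1))⁻¹ * (1 - (H u)⁻¹) = (H u)⁻¹ := by
        rw [hHu] at hu0 ⊢
        field_simp; ring
      have := Submodule.add_mem _ (Submodule.sub_mem _ h2
        (Submodule.smul_mem _ (H (u + 1))⁻¹ h5)) (Submodule.smul_mem _ (H u)⁻¹ h8)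
      convert this using 1
      simp only [smul_add, smul_sub, smul_smul, h9]
      module
    · simp only [hl, if_false]
      convert Submodule.sub_mem _ h2 (Submodule.smul_mem _ (H (u + 1))⁻¹ h5) using 1
      module

lemma PolarizationRel.blockChain_sub_fullChain (h : PolarizationRel E D) (H lam : ℕ → ℂ)
    (r : ℕ) (hH : ∀ q, H q = H (q + 1) + lam q - lam (q + 1) + 1) (h0 : ∀ t < r, H t ≠ 0)
    (hr : H r = 0) {x : M} (hx : x ∈ wtSpace E lam) :
    chain E D (blockCoeff H lam) r x - chain E D (fullCoeff H) r x ∈ blockMoves E lam r := by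
  rcases r with _ | u
  · simp [chain_zero]
  · have h1 := h.fullSum_sub_blockSum H lam (u + 1) hH h0 hx u (by omega) (u + 1) (by omega)
    convert h1 using 1
    rw [blockChain_succ, chain_apply (κ := fullCoeff H)]
    by_cases hl : lam (u + 1) = lam u
    · have : H u = 1 := by rw [hH u, hl, hr]; ring
      simp [fullCoeff, hl, this]
    · simp [fullCoeff, hl]

/-! #### Lowering operators -/

/-- The sum of the images of the lowering operators `E (p + 1) p` in weight `lam`. -/
def lowered (E : ℕ → ℕ → Module.End ℂ M) (lam : ℕ → ℂ) : Submodule ℂ M :=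
  ⨆ p, (wtSpace E (lam + eps p - eps (p + 1))).map (E (p + 1) p)

lemma PolarizationRel.E_mem_lowered (h : PolarizationRel E D) (lam : ℕ → ℂ) {p q : ℕ}
    (hqp : q < p) {x : M} (hx : x ∈ wtSpace E (lam + eps q - eps p)) :
    E p q x ∈ lowered E lam := by
  have hmem : ∀ p, ∀ y ∈ wtSpace E (lam + eps p - eps (p + 1)),
      E (p + 1) p y ∈ lowered E lam := fun p y hy =>
    Submodule.mem_iSup_of_mem p (Submodule.mem_map_of_mem hy)
  induction p, hqp using Nat.le_induction generalizing x with
  | base => exact hmem q x hx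
  | succ p hqp ih =>
    have h1 := h.comm (p + 1) p p q x
    rw [if_pos rfl, if_neg (by omega), sub_zero] at h1
    have h2 := h.wt_E hx p q
    have h3 := h.wt_E hx (p + 1) p
    rw [show lam + eps q - eps (p + 1) + eps p - eps q = lam + eps p - eps (p + 1) by abel]
      at h2
    rw [show lam + eps q - eps (p + 1) + eps (p + 1) - eps p = lam + eps q - eps p by abel]
      at h3
    rw [eq_sub_iff_add_eq'.2 h1.symm]
    exact Submodule.sub_mem _ (hmem p _ h2) (ih h3)

end Chains

/-! ### The polynomial model -/

/-- Polynomials in variables `z_{i,a}`, with `i` a row and `a` an entry. -/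
abbrev RowPoly (n : ℕ) : Type := MvPolynomial (ℕ × Fin n) ℂ

open MvPolynomial in
/-- The polarization `∑ₐ z_{i,a} ∂_{j,a}` as a derivation. -/
def polDer (n i j : ℕ) : Derivation ℂ (RowPoly n) (RowPoly n) :=
  mkDerivation ℂ fun v => if v.1 = j then X (i, v.2) else 0

/-- The polarization `∑ₐ z_{i,a} ∂_{j,a}`, which moves an entry from row `j` to row `i`. -/
def pol (n i j : ℕ) : Module.End ℂ (RowPoly n) := (polDer n i j).toLinearMap

/-- The partial derivative `∂_{i,a}`, which removes an entry `a` from row `i`. -/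
def rowDeriv {n : ℕ} (a : Fin n) (i : ℕ) : Module.End ℂ (RowPoly n) :=
  (MvPolynomial.pderiv (i, a)).toLinearMap

open MvPolynomial in
lemma polDer_X (n i j : ℕ) (v : ℕ × Fin n) :
    polDer n i j (X v) = if v.1 = j then X (i, v.2) else 0 :=
  mkDerivation_X _ _ _

open MvPolynomial in
lemma pol_rel {n : ℕ} (a : Fin n) : PolarizationRel (pol n) (rowDeriv a) where
  comm i j k l x := by
    have h : ⁅polDer n i j, polDer n k l⁆ =
        (if j = k then polDer n i l else 0) - (if l = i then polDer n k j else 0) := by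
      refine derivation_ext fun v => ?_
      obtain ⟨r, b⟩ := v
      rw [Derivation.commutator_apply, polDer_X, polDer_X, Derivation.sub_apply]
      simp only [apply_ite (polDer n i j), apply_ite (polDer n k l), map_zero, polDer_X,
        apply_ite (fun d : Derivation ℂ (RowPoly n) (RowPoly n) => d (X (r, b))),
        Derivation.zero_apply]
      split_ifs <;> subst_vars <;> first | contradiction | simp
    have h' := congrArg (fun d => d x) h
    simp only [Derivation.commutator_apply, Derivation.sub_apply] at h'
    simp only [pol, Derivation.coeFn_coe]
    by_cases h3 : j = k <;> by_cases h4 : l = i <;> simp [h3, h4] at h' ⊢ <;>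
      linear_combination h'
  commD s i j x := by
    have h : ⁅pderiv (R := ℂ) (s, a), polDer n i j⁆ = (if s = i then pderiv (j, a) else 0) := by
      refine derivation_ext fun v => ?_
      obtain ⟨r, b⟩ := v
      rw [Derivation.commutator_apply, polDer_X]
      simp only [apply_ite (polDer n i j), apply_ite (pderiv (R := ℂ) (s, a)), map_zero,
        apply_ite (fun d : Derivation ℂ (RowPoly n) (RowPoly n) => d (X (r, b))),
        Derivation.zero_apply, pderiv_X, Pi.single_apply, Prod.mk.injEq]
      split_ifs <;> subst_vars <;> simp <;> grind
    have h' := congrArg (fun d => d x) h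
    simp only [Derivation.commutator_apply] at h'
    simp only [pol, rowDeriv, Derivation.coeFn_coe]
    by_cases h2 : s = i <;> simp [h2] at h' ⊢ <;> linear_combination h'

open MvPolynomial in
lemma polDer_apply (n i j : ℕ) (f : RowPoly n) :
    polDer n i j f = ∑ a : Fin n, X (i, a) * pderiv (j, a) f := by
  induction f using MvPolynomial.induction_on with
  | C c => simp
  | add p q hp hq => simp [hp, hq, mul_add, Finset.sum_add_distrib]
  | mul_X p v hp =>
    obtain ⟨r, b⟩ := v
    rw [Derivation.leibniz, hp, polDer_X]
    simp only [Derivation.leibniz, pderiv_X, Pi.single_apply, Prod.mk.injEq, smul_eq_mul,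
      mul_add, Finset.sum_add_distrib, mul_ite, mul_one, mul_zero]
    congr 1
    · by_cases h : r = j <;> simp [h, mul_comm]
    · rw [Finset.mul_sum]
      exact Finset.sum_congr rfl fun _ _ => by ring

open MvPolynomial in
lemma pol_self_monomial (n i : ℕ) (d : ℕ × Fin n →₀ ℕ) (c : ℂ) :
    pol n i i (monomial d c) = (∑ a : Fin n, (d (i, a) : ℂ)) • monomial d c := by
  simp only [pol, Derivation.coeFn_coe, polDer_apply, X_mul_pderiv_monomial, Finset.sum_smul,
    Nat.cast_smul_eq_nsmul]

open MvPolynomial in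
lemma coeff_pol_self (n i : ℕ) (d : ℕ × Fin n →₀ ℕ) (f : RowPoly n) :
    coeff d (pol n i i f) = (∑ a : Fin n, (d (i, a) : ℂ)) * coeff d f := by
  induction f using MvPolynomial.induction_on' with
  | monomial e c =>
    rw [pol_self_monomial, coeff_smul, coeff_monomial]
    by_cases h : e = d <;> simp [h]
  | add p q hp hq => rw [map_add, coeff_add, coeff_add, hp, hq, mul_add]

/-- In a weight vector of the polarization operators, each monomial has the prescribed
degrees in the rows. -/
lemma degree_of_mem_wtSpace {n : ℕ} {ν : ℕ → ℂ} {f : RowPoly n} (hf : f ∈ wtSpace (pol n) ν)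
    {d : ℕ × Fin n →₀ ℕ} (hd : MvPolynomial.coeff d f ≠ 0) (i : ℕ) :
    ∑ a : Fin n, (d (i, a) : ℂ) = ν i := by
  have h := congrArg (MvPolynomial.coeff d) (hf i)
  rw [coeff_pol_self, MvPolynomial.coeff_smul, smul_eq_mul] at h
  exact mul_right_cancel₀ hd h

section RowMon

variable {B : Type*} [Fintype B] {n : ℕ}

open MvPolynomial in
/-- The monomial `∏_b z_{ρ b, T b}` attached to a placement `ρ` of the boxes in rows and a
filling `T`. -/
def rowMon (ρ : B → ℕ) (T : B → Fin n) : RowPoly n := ∏ b, X (ρ b, T b)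

open MvPolynomial in
lemma rowMon_eq_monomial (ρ : B → ℕ) (T : B → Fin n) :
    rowMon ρ T = monomial (∑ b, Finsupp.single (ρ b, T b) 1) 1 := by
  rw [monomial_sum_one]; rfl

lemma derivation_prod {ι : Type*} [DecidableEq ι] (s : Finset ι)
    (d : Derivation ℂ (RowPoly n) (RowPoly n))
    (f : ι → RowPoly n) : d (∏ i ∈ s, f i) = ∑ i ∈ s, d (f i) * ∏ j ∈ s.erase i, f j := by
  induction s using Finset.induction_on with
  | empty => simp
  | insert a s ha ih =>
    rw [Finset.prod_insert ha, Derivation.leibniz, ih, Finset.sum_insert ha,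
      Finset.erase_insert ha, smul_eq_mul, smul_eq_mul, Finset.mul_sum, add_comm]
    congr 1
    · ring
    · refine Finset.sum_congr rfl fun i hi => ?_
      have hia : i ≠ a := fun h => ha (h ▸ hi)
      rw [Finset.erase_insert_of_ne hia.symm, Finset.prod_insert (by simp [ha])]
      ring

lemma pol_rowMon [DecidableEq B] (ρ : B → ℕ) (T : B → Fin n) (i j : ℕ) :
    pol n i j (rowMon ρ T) =
      ∑ b ∈ Finset.univ.filter (fun b => ρ b = j), rowMon (Function.update ρ b i) T := by
  rw [rowMon, pol, Derivation.coeFn_coe, derivation_prod, Finset.sum_filter]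
  refine Finset.sum_congr rfl fun b _ => ?_
  rw [polDer_X]
  by_cases h : ρ b = j
  · rw [if_pos h, if_pos h, rowMon, ← Finset.mul_prod_erase _ _ (Finset.mem_univ b),
      Function.update_self]
    congr 1
    refine Finset.prod_congr rfl fun c hc => ?_
    rw [Function.update_of_ne (Finset.ne_of_mem_erase hc)]
  · simp [h]

lemma rowMon_mem_wtSpace (ρ : B → ℕ) (T : B → Fin n) :
    rowMon ρ T ∈ wtSpace (pol n)
      (fun i => ((Finset.univ.filter fun b => ρ b = i).card : ℂ)) := by
  intro i
  rw [pol_rowMon, Nat.cast_smul_eq_nsmul, ← Finset.sum_const]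
  refine Finset.sum_congr rfl fun b hb => ?_
  rw [← (Finset.mem_filter.1 hb).2, Function.update_eq_self]

lemma exists_filling (ρ : B → ℕ) (d : ℕ × Fin n →₀ ℕ)
    (hd : ∀ i, ∑ a : Fin n, d (i, a) = (Finset.univ.filter fun b => ρ b = i).card) :
    ∃ T : B → Fin n, d = ∑ b, Finsupp.single (ρ b, T b) 1 := by
  have hne : ∀ b : B, Nonempty (Fin n) := fun b => by
    by_contra h
    rw [not_nonempty_iff] at h
    have := hd (ρ b)
    simp only [Finset.univ_eq_empty, Finset.sum_empty] at this
    exact Finset.card_ne_zero_of_mem (s := Finset.univ.filter fun c => ρ c = ρ b) (a := b)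
      (by simp) this.symm
  suffices H : ∀ (s : Finset B) (d : ℕ × Fin n →₀ ℕ),
      (∀ i, ∑ a : Fin n, d (i, a) = (s.filter fun b => ρ b = i).card) →
      ∃ T : B → Fin n, d = ∑ b ∈ s, Finsupp.single (ρ b, T b) 1 from H _ d hd
  intro s
  induction s using Finset.induction_on with
  | empty =>
    intro d hd
    refine ⟨fun b => (hne b).some, ?_⟩
    ext ⟨i, a⟩
    have := hd i
    simp only [Finset.filter_empty, Finset.card_empty, Finset.sum_eq_zero_iff] at this
    simpa using this a (Finset.mem_univ a)
  | insert b s hb ih =>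
    intro d hd
    have h1 : ∑ a : Fin n, d (ρ b, a) ≠ 0 := by
      rw [hd]
      exact Finset.card_ne_zero_of_mem (Finset.mem_filter.2 ⟨Finset.mem_insert_self b s, rfl⟩)
    obtain ⟨a, -, ha⟩ := Finset.exists_ne_zero_of_sum_ne_zero h1
    have hle : Finsupp.single (ρ b, a) 1 ≤ d := by
      rw [Finsupp.single_le_iff]; omega
    obtain ⟨e, rfl⟩ := exists_add_of_le hle
    have he : ∀ i, ∑ a : Fin n, e (i, a) = (s.filter fun b => ρ b = i).card := by
      intro i
      have := hd i
      rw [Finset.filter_insert] at this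
      simp only [Finsupp.add_apply, Finset.sum_add_distrib] at this
      by_cases hi : ρ b = i
      · subst hi
        rw [if_pos rfl, Finset.card_insert_of_notMem (by simp [hb]),
          Finset.sum_eq_single a] at this
        · simp at this; omega
        · intro c _ hc; simp [hc.symm]
        · simp
      · rw [if_neg hi, Finset.sum_eq_zero] at this
        · simpa using this
        · intro c _; simp [hi]
    obtain ⟨T, rfl⟩ := ih e he
    refine ⟨Function.update T b a, ?_⟩
    rw [Finset.sum_insert hb, Function.update_self]
    congr 1
    refine Finset.sum_congr rfl fun c hc => ?_
    rw [Function.update_of_ne (ne_of_mem_of_not_mem hc hb)]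

lemma wtSpace_le_span (ρ : B → ℕ) {f : RowPoly n}
    (hf : f ∈ wtSpace (pol n)
      (fun i => ((Finset.univ.filter fun b => ρ b = i).card : ℂ))) :
    f ∈ Submodule.span ℂ (Set.range (rowMon (n := n) ρ)) := by
  rw [f.as_sum]
  refine Submodule.sum_mem _ fun d hd => ?_
  obtain ⟨T, hT⟩ := exists_filling ρ d fun i => by
    exact_mod_cast degree_of_mem_wtSpace hf (MvPolynomial.mem_support_iff.1 hd) i
  have : MvPolynomial.monomial d (MvPolynomial.coeff d f) =
      MvPolynomial.coeff d f • rowMon ρ T := by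
    rw [rowMon_eq_monomial, ← hT, MvPolynomial.smul_monomial, smul_eq_mul, mul_one]
  rw [this]
  exact Submodule.smul_mem _ _ (Submodule.subset_span ⟨T, rfl⟩)

lemma exists_perm_of_rowMon_eq (ρ : B → ℕ) {T₁ T₂ : B → Fin n}
    (h : rowMon ρ T₁ = rowMon ρ T₂) :
    ∃ σ : Equiv.Perm B, ∀ b, ρ (σ b) = ρ b ∧ T₂ (σ b) = T₁ b := by
  rw [rowMon_eq_monomial, rowMon_eq_monomial,
    (MvPolynomial.monomial_left_injective one_ne_zero).eq_iff] at h
  have hc : ∀ v, Fintype.card {b // (ρ b, T₁ b) = v} = Fintype.card {b // (ρ b, T₂ b) = v} := by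
    intro v
    have := DFunLike.congr_fun h v
    simpa [Finsupp.finsetSum_apply, Finsupp.single_apply, Fintype.card_subtype] using this
  let e := (Equiv.sigmaFiberEquiv fun b => (ρ b, T₁ b)).symm.trans
    ((Equiv.sigmaCongrRight fun v => Fintype.equivOfCardEq (hc v)).trans
      (Equiv.sigmaFiberEquiv fun b => (ρ b, T₂ b)))
  refine ⟨e, fun b => ?_⟩
  have : (ρ (e b), T₂ (e b)) = (ρ b, T₁ b) :=
    (Fintype.equivOfCardEq (hc (ρ b, T₁ b)) ⟨b, rfl⟩).2
  exact Prod.mk.inj this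

end RowMon

/-! ### Tableaux as monomials -/

lemma perm_apply_inv_self {B : Type*} (σ : Equiv.Perm B) (x : B) : σ (σ⁻¹ x) = x :=
  σ.apply_symm_apply x

lemma perm_inv_apply_self {B : Type*} (σ : Equiv.Perm B) (x : B) : σ⁻¹ (σ x) = x :=
  σ.symm_apply_apply x

/-- The row of a box. -/
abbrev boxRow (K : Finset Cell) : BoxOf K → ℕ := fun c => c.val.1

/-- The row widths of a shape, as a weight. -/
def widths (K : Finset Cell) : ℕ → ℂ := fun i => (rowWidth K i : ℂ)

lemma card_filter_boxRow (K : Finset Cell) (i : ℕ) :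
    (Finset.univ.filter fun b => boxRow K b = i).card = rowWidth K i := by
  rw [rowWidth, ← Finset.card_map (Function.Embedding.subtype _)]
  congr 1
  ext c
  simp only [boxRow, Finset.mem_map, Finset.mem_filter, Finset.mem_univ, true_and,
    Function.Embedding.subtype_apply]
  exact ⟨fun ⟨b, hb, hc⟩ => hc ▸ ⟨b.2, hb⟩, fun ⟨hK, hi⟩ => ⟨⟨c, hK⟩, hi, rfl⟩⟩

lemma card_rowBoxes (K : Finset Cell) (i : ℕ) : (rowBoxes K i).card = rowWidth K i :=
  card_filter_boxRow K i

lemma mem_rowBoxes {K : Finset Cell} {i : ℕ} {b : BoxOf K} :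
    b ∈ rowBoxes K i ↔ b.val.1 = i := by
  simp [rowBoxes]

/-- The linear map sending a tableau to its monomial. -/
def monL (K : Finset Cell) (n : ℕ) : FreeT K n →ₗ[ℂ] RowPoly n :=
  Finsupp.lift (RowPoly n) ℂ (Tab K n) fun T => rowMon (boxRow K) T

variable {K : Finset Cell} {n : ℕ}

@[simp] lemma monL_single (T : Tab K n) (c : ℂ) :
    monL K n (Finsupp.single T c) = c • rowMon (boxRow K) T := by
  simp [monL]

lemma monL_mem_wtSpace (z : FreeT K n) : monL K n z ∈ wtSpace (pol n) (widths K) := by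
  induction z using Finsupp.induction_linear with
  | zero => simp
  | add f g hf hg => rw [map_add]; exact Submodule.add_mem _ hf hg
  | single T c =>
    rw [monL_single]
    have := rowMon_mem_wtSpace (boxRow K) T
    simp only [card_filter_boxRow] at this
    exact Submodule.smul_mem _ _ this

lemma rowSpan_le_Rmod : rowSpan K n ≤ Rmod K n :=
  Submodule.span_mono Set.subset_union_left

lemma garnir_mem_Rmod {A : Finset (BoxOf K)} (hA : wA K A < A.card) (T : Tab K n) :
    garnir A T ∈ Rmod K n :=
  Submodule.subset_span (Or.inr ⟨A, T, hA, rfl⟩)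

lemma single_sub_single_mem_rowSpan {T₁ T₂ : Tab K n}
    (h : rowMon (boxRow K) T₁ = rowMon (boxRow K) T₂) :
    Finsupp.single T₁ (1 : ℂ) - Finsupp.single T₂ 1 ∈ rowSpan K n := by
  obtain ⟨σ, hσ⟩ := exists_perm_of_rowMon_eq _ h
  refine Submodule.subset_span ⟨T₁, T₂, ⟨σ, fun x => (hσ x).1, ?_⟩, rfl⟩
  funext x
  rw [permAct, ← (hσ _).2, perm_apply_inv_self]

open MvPolynomial in
lemma mem_rowSpan_of_monL_eq_zero {z : FreeT K n} (hz : monL K n z = 0) : z ∈ rowSpan K n := by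
  let s : RowPoly n →ₗ[ℂ] (FreeT K n ⧸ rowSpan K n) :=
    (basisMonomials (ℕ × Fin n) ℂ).constr ℂ fun d =>
      if h : ∃ T : Tab K n, rowMon (boxRow K) T = monomial d 1 then
        (rowSpan K n).mkQ (Finsupp.single h.choose 1) else 0
  have hs : s ∘ₗ monL K n = (rowSpan K n).mkQ := by
    ext T
    simp only [LinearMap.comp_apply, Finsupp.lsingle_apply, monL_single, one_smul]
    have hT : ∃ T' : Tab K n, rowMon (boxRow K) T' =
        monomial (∑ b, Finsupp.single (boxRow K b, T b) 1) 1 := ⟨T, rowMon_eq_monomial _ _⟩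
    have : s (rowMon (boxRow K) T) = (rowSpan K n).mkQ (Finsupp.single hT.choose 1) := by
      rw [rowMon_eq_monomial]
      exact ((basisMonomials (ℕ × Fin n) ℂ).constr_basis ℂ _ _).trans (dif_pos hT)
    rw [this, ← sub_eq_zero, ← map_sub]
    exact (Submodule.Quotient.mk_eq_zero _).2 (single_sub_single_mem_rowSpan
      (hT.choose_spec.trans (rowMon_eq_monomial _ _).symm))
  have := LinearMap.congr_fun hs z
  rw [LinearMap.comp_apply, hz, map_zero] at this
  exact (Submodule.Quotient.mk_eq_zero _).1 this.symm

lemma mem_Rmod_of_monL_mem {z : FreeT K n} (hz : monL K n z ∈ (Rmod K n).map (monL K n)) :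
    z ∈ Rmod K n := by
  obtain ⟨y, hy, hyz⟩ := hz
  have : z - y ∈ rowSpan K n := mem_rowSpan_of_monL_eq_zero (by rw [map_sub, hyz, sub_self])
  simpa using (Rmod K n).add_mem (rowSpan_le_Rmod this) hy

/-! ### Garnir elements -/

lemma permAct_permAct (σ τ : Equiv.Perm (BoxOf K)) (T : Tab K n) :
    permAct σ (permAct τ T) = permAct (σ * τ) T := by
  funext x
  simp [permAct]

lemma permL_single (σ : Equiv.Perm (BoxOf K)) (T : Tab K n) (c : ℂ) :
    permL K n σ (Finsupp.single T c) = Finsupp.single (permAct σ T) c := by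
  simp [permL]

lemma rowMon_permAct (σ : Equiv.Perm (BoxOf K)) (T : Tab K n) :
    rowMon (boxRow K) (permAct σ T) = rowMon (boxRow K ∘ σ) T := by
  rw [rowMon, rowMon, ← Equiv.prod_comp σ]
  simp [permAct]

lemma mem_SA {A : Finset (BoxOf K)} {σ : Equiv.Perm (BoxOf K)} :
    σ ∈ SA A ↔ ∀ x, x ∉ A → σ x = x := by
  simp [SA]

lemma SA_mul {A : Finset (BoxOf K)} {σ τ : Equiv.Perm (BoxOf K)} (hσ : σ ∈ SA A)
    (hτ : τ ∈ SA A) : σ * τ ∈ SA A := by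
  rw [mem_SA] at *
  intro x hx
  rw [Equiv.Perm.mul_apply, hτ x hx, hσ x hx]

lemma SA_inv {A : Finset (BoxOf K)} {σ : Equiv.Perm (BoxOf K)} (hσ : σ ∈ SA A) :
    σ⁻¹ ∈ SA A := by
  rw [mem_SA] at *
  intro x hx
  rw [Equiv.Perm.inv_eq_iff_eq, hσ x hx]

lemma SA_mono {A B : Finset (BoxOf K)} (h : A ⊆ B) : SA A ⊆ SA B := fun _ hσ =>
  mem_SA.2 fun x hx => mem_SA.1 hσ x fun hA => hx (h hA)

lemma swap_mem_SA {A : Finset (BoxOf K)} {c d : BoxOf K} (hc : c ∈ A) (hd : d ∈ A) :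
    Equiv.swap c d ∈ SA A := by
  rw [mem_SA]
  intro x hx
  exact Equiv.swap_apply_of_ne_of_ne (fun h => hx (h ▸ hc)) (fun h => hx (h ▸ hd))

lemma apply_mem_of_mem_SA {A : Finset (BoxOf K)} {σ : Equiv.Perm (BoxOf K)} (hσ : σ ∈ SA A)
    {x : BoxOf K} (hx : x ∈ A) : σ x ∈ A := by
  by_contra h
  have := mem_SA.1 (SA_inv hσ) _ h
  rw [perm_inv_apply_self] at this
  exact h (this ▸ hx)

lemma sum_SA_inv {M : Type*} [AddCommMonoid M] (A : Finset (BoxOf K))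
    (f : Equiv.Perm (BoxOf K) → M) : ∑ σ ∈ SA A, f σ⁻¹ = ∑ σ ∈ SA A, f σ :=
  Finset.sum_nbij' (fun σ => σ⁻¹) (fun σ => σ⁻¹) (fun _ => SA_inv) (fun _ => SA_inv)
    (fun _ _ => inv_inv _) (fun _ _ => inv_inv _) fun _ _ => rfl

lemma sum_SA_apply {M : Type*} [AddCommMonoid M] {A : Finset (BoxOf K)} {d : BoxOf K}
    (hd : d ∈ A) (F : BoxOf K → M) :
    A.card • ∑ σ ∈ SA A, F (σ⁻¹ d) = (SA A).card • ∑ c ∈ A, F c := by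
  have h1 : ∀ c ∈ A, ∑ σ ∈ SA A, F (σ⁻¹ d) = ∑ σ ∈ SA A, F (σ⁻¹ c) := fun c hc => by
    refine Finset.sum_nbij' (fun σ => Equiv.swap c d * σ) (fun σ => Equiv.swap c d * σ)
      (fun σ hσ => SA_mul (swap_mem_SA hc hd) hσ) (fun σ hσ => SA_mul (swap_mem_SA hc hd) hσ)
      ?_ ?_ ?_ <;> intro σ _ <;> simp [← mul_assoc]
  rw [← Finset.sum_const, Finset.sum_congr rfl h1, Finset.sum_comm, ← Finset.sum_const]
  refine Finset.sum_congr rfl fun σ hσ => ?_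
  exact Finset.sum_nbij' (fun c => σ⁻¹ c) (fun c => σ c)
    (fun c hc => apply_mem_of_mem_SA (SA_inv hσ) hc) (fun c hc => apply_mem_of_mem_SA hσ hc)
    (fun _ _ => by simp) (fun _ _ => by simp) fun _ _ => rfl

lemma sum_SA_insert {M : Type*} [AddCommMonoid M] {A : Finset (BoxOf K)} {c : BoxOf K}
    (hc : c ∉ A) (f : Equiv.Perm (BoxOf K) → M) :
    ∑ σ ∈ SA (insert c A), f σ =
      ∑ d ∈ insert c A, ∑ τ ∈ SA A, f (τ * Equiv.swap c d) := by
  have hA : A ⊆ insert c A := Finset.subset_insert _ _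
  have hcA : c ∈ insert c A := Finset.mem_insert_self _ _
  rw [Finset.sum_sigma']
  refine Finset.sum_nbij' (fun σ => ⟨σ⁻¹ c, σ * Equiv.swap c (σ⁻¹ c)⟩)
    (fun p => p.2 * Equiv.swap c p.1) ?_ ?_ ?_ ?_ ?_
  · intro σ hσ
    have hd := apply_mem_of_mem_SA (SA_inv hσ) hcA
    refine Finset.mem_sigma.2 ⟨hd, mem_SA.2 fun x hx => ?_⟩
    by_cases hxc : x = c
    · simp [hxc]
    · exact mem_SA.1 (SA_mul hσ (swap_mem_SA hcA hd)) x (by simp [hxc, hx])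
  · rintro ⟨d, τ⟩ h
    obtain ⟨hd, hτ⟩ := Finset.mem_sigma.1 h
    exact SA_mul (SA_mono hA hτ) (swap_mem_SA hcA hd)
  · intro σ _
    simp [mul_assoc]
  · rintro ⟨d, τ⟩ h
    obtain ⟨hd, hτ⟩ := Finset.mem_sigma.1 h
    have h1 : τ.symm c = c := mem_SA.1 (SA_inv hτ) c hc
    simp [h1, mul_assoc]
  · intro σ _
    simp [mul_assoc]

lemma garnir_insert {A : Finset (BoxOf K)} {c : BoxOf K} (hc : c ∉ A) (T : Tab K n) :
    garnir (insert c A) T = ∑ d ∈ insert c A, garnir A (permAct (Equiv.swap c d) T) := by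
  simp only [garnir, permAct_permAct]
  exact sum_SA_insert hc _

lemma garnir_insert_left {A : Finset (BoxOf K)} {c : BoxOf K} (hc : c ∉ A) (T : Tab K n) :
    garnir (insert c A) T = ∑ d ∈ insert c A, permL K n (Equiv.swap c d) (garnir A T) := by
  simp only [garnir, map_sum, permL_single, permAct_permAct]
  rw [← sum_SA_inv, sum_SA_insert hc]
  refine Finset.sum_congr rfl fun d _ => ?_
  rw [← sum_SA_inv]
  simp

lemma permL_garnir {A : Finset (BoxOf K)} (π : Equiv.Perm (BoxOf K)) (T : Tab K n) :
    permL K n π (garnir A T) = garnir (A.map π.toEmbedding) (permAct π T) := by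
  simp only [garnir, map_sum, permL_single, permAct_permAct]
  refine Finset.sum_nbij' (fun σ => π * σ * π⁻¹) (fun σ => π⁻¹ * σ * π) ?_ ?_ ?_ ?_ ?_
  · intro σ hσ
    rw [mem_SA] at *
    intro x hx
    simp only [Equiv.Perm.mul_apply]
    rw [hσ, perm_apply_inv_self]
    intro h
    exact hx (Finset.mem_map.2 ⟨_, h, by simp⟩)
  · intro σ hσ
    rw [mem_SA] at *
    intro x hx
    simp only [Equiv.Perm.mul_apply]
    rw [hσ, perm_inv_apply_self]
    simpa using hx
  all_goals intro σ _; simp [mul_assoc]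

lemma garnir_mem_of_subset (N : Submodule ℂ (FreeT K n)) {A₀ A : Finset (BoxOf K)}
    (h : A₀ ⊆ A) (hN : ∀ T, garnir A₀ T ∈ N) (T : Tab K n) : garnir A T ∈ N := by
  suffices H : ∀ (S : Finset (BoxOf K)) (T : Tab K n), garnir (A₀ ∪ S) T ∈ N by
    have := H A T
    rwa [Finset.union_eq_right.2 h] at this
  intro S
  induction S using Finset.induction_on with
  | empty => simpa using hN
  | insert c S _ ih =>
    intro T
    rw [Finset.union_insert]
    by_cases hc : c ∈ A₀ ∪ S
    · rw [Finset.insert_eq_of_mem hc]; exact ih T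
    · rw [garnir_insert hc]
      exact Submodule.sum_mem _ fun d _ => ih _

lemma permL_sub_mem (N : Submodule ℂ (FreeT K n)) (hrow : rowSpan K n ≤ N)
    {σ : Equiv.Perm (BoxOf K)} (hσ : ∀ x, (σ x).val.1 = x.val.1) (z : FreeT K n) :
    permL K n σ z - z ∈ N := by
  induction z using Finsupp.induction_linear with
  | zero => simp
  | add f g hf hg =>
    rw [map_add, add_sub_add_comm]
    exact N.add_mem hf hg
  | single T c =>
    have h : Finsupp.single T (1 : ℂ) - Finsupp.single (permAct σ T) 1 ∈ N :=
      hrow (Submodule.subset_span ⟨T, _, ⟨σ, hσ, rfl⟩, rfl⟩)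
    have := N.smul_mem (-c) h
    rw [permL_single]
    simpa [smul_sub, sub_eq_add_neg, add_comm] using this

/-- The Garnir elements that mix a full row with one box of a lower row generate all of them. -/
lemma garnir_mem_of_basic (N : Submodule ℂ (FreeT K n)) (hrow : rowSpan K n ≤ N)
    (hbasic : ∀ (q : ℕ) (b : BoxOf K) (T : Tab K n), q < b.val.1 →
      garnir (insert b (rowBoxes K q)) T ∈ N) (q : ℕ) (A : Finset (BoxOf K))
    (hq : ∀ b ∈ A, q ≤ b.val.1) (hA : rowWidth K q < A.card) (T : Tab K n) :
    garnir A T ∈ N := by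
  induction hk : (rowBoxes K q \ A).card generalizing A T with
  | zero =>
    have hsub : rowBoxes K q ⊆ A := by
      rwa [Finset.card_eq_zero, Finset.sdiff_eq_empty_iff_subset] at hk
    obtain ⟨b, hbA, hb⟩ : ∃ b ∈ A, b ∉ rowBoxes K q :=
      Finset.exists_mem_notMem_of_card_lt_card (by rwa [card_rowBoxes])
    have hqb : q < b.val.1 := lt_of_le_of_ne (hq b hbA) fun h => hb (mem_rowBoxes.2 h.symm)
    exact garnir_mem_of_subset N (Finset.insert_subset hbA hsub) (fun T => hbasic q b T hqb) T
  | succ k ih =>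
    obtain ⟨c, hc⟩ : (rowBoxes K q \ A).Nonempty := Finset.card_pos.1 (by omega)
    obtain ⟨hcq, hcA⟩ := Finset.mem_sdiff.1 hc
    have hcq' := mem_rowBoxes.1 hcq
    have hstep : ∀ A' : Finset (BoxOf K), rowBoxes K q \ A' = (rowBoxes K q \ A).erase c →
        (rowBoxes K q \ A').card = k := fun A' h => by
      rw [h, Finset.card_erase_of_mem hc, hk, Nat.add_sub_cancel]
    have h1 : garnir (insert c A) T ∈ N := by
      refine ih _ ?_ ?_ T (hstep _ ?_)
      · intro b hb
        rcases Finset.mem_insert.1 hb with rfl | hb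
        · exact hcq'.ge
        · exact hq b hb
      · rw [Finset.card_insert_of_notMem hcA]; omega
      · ext x; simp only [Finset.mem_sdiff, Finset.mem_insert, Finset.mem_erase]; tauto
    have h2 : ∀ d ∈ A, permL K n (Equiv.swap c d) (garnir A T) -
        (if d.val.1 = q then garnir A T else 0) ∈ N := by
      intro d hd
      by_cases hdq : d.val.1 = q
      · rw [if_pos hdq]
        refine permL_sub_mem N hrow (fun x => ?_) _
        by_cases hxc : x = c
        · rw [hxc, Equiv.swap_apply_left, hcq', hdq]
        · by_cases hxd : x = d
          · rw [hxd, Equiv.swap_apply_right, hcq', hdq]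
          · rw [Equiv.swap_apply_of_ne_of_ne hxc hxd]
      · rw [if_neg hdq, sub_zero, permL_garnir]
        have hmap : A.map (Equiv.swap c d).toEmbedding = insert c (A.erase d) := by
          ext x
          simp only [Finset.mem_map_equiv, Equiv.symm_swap, Finset.mem_insert, Finset.mem_erase]
          by_cases hxc : x = c
          · simp [hxc, hd]
          · by_cases hxd : x = d
            · simp [hxd, hcA, show d ≠ c from fun h => hcA (h ▸ hd)]
            · rw [Equiv.swap_apply_of_ne_of_ne hxc hxd]; simp [hxc, hxd]
        refine ih _ ?_ ?_ _ (hstep _ ?_)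
        · rw [hmap]
          intro b hb
          rcases Finset.mem_insert.1 hb with rfl | hb
          · exact hcq'.ge
          · exact hq b (Finset.mem_of_mem_erase hb)
        · rwa [Finset.card_map]
        · rw [hmap]
          ext x
          simp only [Finset.mem_sdiff, Finset.mem_insert, Finset.mem_erase]
          have : x ∈ rowBoxes K q → x ≠ d := fun hx h => hdq (h ▸ mem_rowBoxes.1 hx)
          tauto
    rw [garnir_insert_left hcA, Finset.sum_insert hcA, Equiv.swap_self] at h1
    have h3 := N.sub_mem h1 (Submodule.sum_mem N h2)
    have h4 : permL K n (Equiv.refl _) (garnir A T) = garnir A T := by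
      have := permL_garnir (A := A) (Equiv.refl _) T
      rwa [show A.map (Equiv.refl (BoxOf K)).toEmbedding = A from Finset.map_refl,
        show permAct (Equiv.refl (BoxOf K)) T = T from rfl] at this
    rw [Finset.sum_sub_distrib, h4, Finset.sum_ite, Finset.sum_const, Finset.sum_const_zero] at h3
    set m := (A.filter fun d => d.val.1 = q).card
    have h5 : ((m : ℂ) + 1) • garnir A T ∈ N := by
      rw [add_smul, one_smul, Nat.cast_smul_eq_nsmul]
      convert h3 using 1
      abel
    exact (N.smul_mem_iff (Nat.cast_add_one_ne_zero m)).1 h5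

lemma Rmod_le_of_basic (N : Submodule ℂ (FreeT K n)) (hrow : rowSpan K n ≤ N)
    (hbasic : ∀ (q : ℕ) (b : BoxOf K) (T : Tab K n), q < b.val.1 →
      garnir (insert b (rowBoxes K q)) T ∈ N) : Rmod K n ≤ N := by
  refine Submodule.span_le.2 (Set.union_subset (Submodule.span_le.1 hrow) ?_)
  rintro z ⟨A, T, hA, rfl⟩
  have hne : A.Nonempty := Finset.card_pos.1 (by omega)
  obtain ⟨b, hb, hmin⟩ := A.exists_min_image (fun b => b.val.1) hne
  exact garnir_mem_of_basic N hrow hbasic b.val.1 A hmin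
    (lt_of_le_of_lt (Finset.le_sup (f := fun x : BoxOf K => rowWidth K x.val.1) hb) hA) T

lemma monL_garnir_basic {q : ℕ} {b : BoxOf K} (hb : b.val.1 ≠ q) (T : Tab K n) :
    (insert b (rowBoxes K q)).card • monL K n (garnir (insert b (rowBoxes K q)) T) =
      (SA (insert b (rowBoxes K q))).card •
        pol n b.val.1 q (rowMon (Function.update (boxRow K) b q) T) := by
  set A := insert b (rowBoxes K q) with hA
  have hbA : b ∈ A := Finset.mem_insert_self _ _
  have hfilter : (Finset.univ.filter fun c => Function.update (boxRow K) b q c = q) = A := by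
    ext c
    rw [hA, Finset.mem_filter, Finset.mem_insert, mem_rowBoxes]
    by_cases hc : c = b
    · simp [hc]
    · simp [hc]
  rw [pol_rowMon, hfilter, ← sum_SA_apply hbA]
  congr 1
  rw [garnir, map_sum]
  refine Finset.sum_congr rfl fun σ hσ => ?_
  rw [monL_single, one_smul, rowMon_permAct]
  congr 1
  funext c
  rw [Function.comp_apply]
  by_cases hc : c = σ⁻¹ b
  · rw [hc, Function.update_self, perm_apply_inv_self]
  · have hσc : σ c ≠ b := fun h => hc (by rw [← h, perm_inv_apply_self])
    rw [Function.update_of_ne hc]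
    by_cases hcA : c ∈ A
    · have h1 := apply_mem_of_mem_SA hσ hcA
      have h2 : (σ c).val.1 = q := by
        rcases Finset.mem_insert.1 h1 with h | h
        · exact absurd h hσc
        · exact mem_rowBoxes.1 h
      rw [← hfilter, Finset.mem_filter] at hcA
      rw [hcA.2]; exact h2
    · rw [mem_SA.1 hσ c hcA, Function.update_of_ne]
      rintro rfl
      exact hcA hbA

lemma card_update_boxRow (q : ℕ) (b : BoxOf K) :
    (fun i => ((Finset.univ.filter fun c => Function.update (boxRow K) b q c = i).card : ℂ)) =
      widths K + eps q - eps b.val.1 := by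
  funext i
  have h : ∀ i, ((Finset.univ.filter fun c => boxRow K c = i).card : ℂ) = widths K i :=
    fun i => by rw [card_filter_boxRow]; rfl
  rw [Pi.sub_apply, Pi.add_apply, ← h]
  simp only [Finset.card_filter, eps, Pi.single_apply]
  rw [← Finset.add_sum_erase _ _ (Finset.mem_univ b),
    ← Finset.add_sum_erase _ (fun c => if boxRow K c = i then 1 else 0) (Finset.mem_univ b),
    Function.update_self]
  rw [Finset.sum_congr rfl fun c hc => by
    rw [Function.update_of_ne (Finset.ne_of_mem_erase hc)]]
  push_cast
  simp only [eq_comm (a := i)]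
  ring

lemma monL_mem_lowered [Nonempty (Fin n)] {z : FreeT K n} (hz : z ∈ Rmod K n) :
    monL K n z ∈ lowered (pol n) (widths K) := by
  refine (Rmod_le_of_basic ((lowered (pol n) (widths K)).comap (monL K n)) ?_ ?_) hz
  · refine Submodule.span_le.2 ?_
    rintro z ⟨T₁, T₂, ⟨σ, hσ, rfl⟩, rfl⟩
    have : rowMon (boxRow K) (permAct σ T₁) = rowMon (boxRow K) T₁ := by
      rw [rowMon_permAct]; congr 1; funext x; exact hσ x
    simp [this]
  · intro q b T hqb
    have h := monL_garnir_basic hqb.ne' T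
    have hw := rowMon_mem_wtSpace (Function.update (boxRow K) b q) T
    rw [card_update_boxRow] at hw
    have h2 := (pol_rel (Classical.arbitrary (Fin n))).E_mem_lowered (widths K) hqb hw
    have h3 := Submodule.smul_of_tower_mem _ (SA (insert b (rowBoxes K q))).card h2
    rw [← h, ← Nat.cast_smul_eq_nsmul ℂ] at h3
    refine (Submodule.smul_mem_iff (lowered (pol n) (widths K)) ?_).1 h3
    exact Nat.cast_ne_zero.2 (Finset.card_ne_zero_of_mem (Finset.mem_insert_self _ _))

/-- Moving an entry from a weakly longer row `q` to a row `p` gives a relation. -/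
lemma pol_mem_map_Rmod {p q : ℕ} (hpq : p ≠ q) (hle : rowWidth K p ≤ rowWidth K q)
    {w : RowPoly n} (hw : w ∈ wtSpace (pol n) (widths K + eps q - eps p)) :
    pol n p q w ∈ (Rmod K n).map (monL K n) := by
  by_cases hp : rowWidth K p = 0
  · have : w = 0 := by
      by_contra hne
      obtain ⟨d, hd⟩ := MvPolynomial.ne_zero_iff.1 hne
      have := degree_of_mem_wtSpace hw hd p
      simp only [Pi.sub_apply, Pi.add_apply, widths, hp, eps, Pi.single_eq_same,
        Pi.single_eq_of_ne hpq, Nat.cast_zero] at this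
      have h2 : ((∑ a : Fin n, d (p, a) + 1 : ℕ) : ℂ) = 0 := by
        push_cast; rw [this]; ring
      exact absurd (Nat.cast_eq_zero.1 h2) (by omega)
    rw [this, map_zero]
    exact Submodule.zero_mem _
  · obtain ⟨b, hb⟩ : (rowBoxes K p).Nonempty := by
      rw [← Finset.card_pos, card_rowBoxes]; omega
    obtain rfl := mem_rowBoxes.1 hb
    rw [← card_update_boxRow] at hw
    have hspan := wtSpace_le_span _ hw
    refine (Submodule.span_le (p := ((Rmod K n).map (monL K n)).comap (pol n b.val.1 q))).2 ?_
      hspan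
    rintro _ ⟨T, rfl⟩
    rw [SetLike.mem_coe, Submodule.mem_comap]
    have hbq : b ∉ rowBoxes K q := fun h => hpq (mem_rowBoxes.1 h)
    have hcard : wA K (insert b (rowBoxes K q)) < (insert b (rowBoxes K q)).card := by
      rw [Finset.card_insert_of_notMem hbq, card_rowBoxes, Nat.lt_succ_iff, wA,
        Finset.sup_le_iff]
      intro c hc
      rcases Finset.mem_insert.1 hc with rfl | hc
      · exact hle
      · rw [mem_rowBoxes.1 hc]
    have h1 : monL K n (garnir (insert b (rowBoxes K q)) T) ∈ (Rmod K n).map (monL K n) :=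
      Submodule.mem_map_of_mem (garnir_mem_Rmod hcard T)
    have h2 := Submodule.smul_of_tower_mem _ (insert b (rowBoxes K q)).card h1
    rw [monL_garnir_basic hpq, ← Nat.cast_smul_eq_nsmul ℂ] at h2
    refine (Submodule.smul_mem_iff _ (Nat.cast_ne_zero.2 ?_)).1 h2
    exact Finset.card_ne_zero_of_mem (a := 1) (mem_SA.2 fun _ _ => rfl)

/-! ### Routes and chains of polarization operators -/

section Routes

/-- A set of boxes above row `s` that has at most one box per row and skips no row above `s`
within a block. -/
structure IsPartialRoute (K : Finset Cell) (s : ℕ) (R : Finset (BoxOf K)) : Prop where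
  lt : ∀ b ∈ R, b.val.1 < s
  one_per_row : ∀ b ∈ R, ∀ b' ∈ R, b.val.1 = b'.val.1 → b = b'
  no_skip : ∀ b ∈ R, ∀ t : ℕ, b.val.1 < t → t < s → rowWidth K t = rowWidth K b.val.1 →
    ∃ b' ∈ R, b'.val.1 = t

/-- The partial routes above row `s`. -/
def partialRoutes (K : Finset Cell) (s : ℕ) : Finset (Finset (BoxOf K)) :=
  Finset.univ.filter fun R => IsPartialRoute K s R

/-- The routes whose lowest box lies in row `s`. -/
def routes (K : Finset Cell) (s : ℕ) : Finset (Finset (BoxOf K)) :=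
  (partialRoutes K (s + 1)).filter fun R => ∃ b ∈ R, b.val.1 = s

variable {K : Finset Cell}

lemma mem_partialRoutes {s : ℕ} {R : Finset (BoxOf K)} :
    R ∈ partialRoutes K s ↔ IsPartialRoute K s R := by
  simp [partialRoutes]

lemma mem_routes {s : ℕ} {R : Finset (BoxOf K)} :
    R ∈ routes K s ↔ IsPartialRoute K (s + 1) R ∧ ∃ b ∈ R, b.val.1 = s := by
  rw [routes, Finset.mem_filter, mem_partialRoutes]

lemma IsPartialRoute.notMem {s : ℕ} {R : Finset (BoxOf K)} (h : IsPartialRoute K s R)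
    {b : BoxOf K} (hb : b.val.1 = s) : b ∉ R := fun hR => (h.lt b hR).ne hb

lemma IsPartialRoute.insert_mem_routes {s : ℕ} {R : Finset (BoxOf K)}
    (h : IsPartialRoute K s R) {b : BoxOf K} (hb : b.val.1 = s) : insert b R ∈ routes K s := by
  refine mem_routes.2 ⟨⟨?_, ?_, ?_⟩, b, Finset.mem_insert_self _ _, hb⟩
  · intro c hc
    rcases Finset.mem_insert.1 hc with rfl | hc
    · omega
    · exact (h.lt c hc).trans (Nat.lt_succ_self s)
  · intro c hc c' hc' hcc
    rcases Finset.mem_insert.1 hc with h1 | h1 <;> rcases Finset.mem_insert.1 hc' with h2 | h2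
    · rw [h1, h2]
    · exact absurd (h.lt c' h2) (by rw [← hcc, h1]; omega)
    · exact absurd (h.lt c h1) (by rw [hcc, h2]; omega)
    · exact h.one_per_row c h1 c' h2 hcc
  · intro c hc r' hr hr' hw
    rcases Finset.mem_insert.1 hc with rfl | hc
    · omega
    · rcases (Nat.lt_succ_iff.1 hr').eq_or_lt with rfl | hlt
      · exact ⟨b, Finset.mem_insert_self _ _, hb⟩
      · obtain ⟨b', hb', h'⟩ := h.no_skip c hc r' hr hlt hw
        exact ⟨b', Finset.mem_insert_of_mem hb', h'⟩

lemma sum_routes {M : Type*} [AddCommMonoid M] (s : ℕ) (F : Finset (BoxOf K) → M) :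
    ∑ R ∈ routes K s, F R =
      ∑ R ∈ partialRoutes K s, ∑ b ∈ rowBoxes K s, F (insert b R) := by
  rw [← Finset.sum_product']
  symm
  refine Finset.sum_nbij (fun p => insert p.2 p.1) ?_ ?_ ?_ fun _ _ => rfl
  · rintro ⟨R, b⟩ h
    obtain ⟨hR, hb⟩ := Finset.mem_product.1 h
    exact (mem_partialRoutes.1 hR).insert_mem_routes (mem_rowBoxes.1 hb)
  · rintro ⟨R, b⟩ h ⟨R', b'⟩ h' heq
    obtain ⟨hR, hb⟩ := Finset.mem_product.1 h
    obtain ⟨hR', hb'⟩ := Finset.mem_product.1 h'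
    have h1 := (mem_partialRoutes.1 hR).notMem (mem_rowBoxes.1 hb)
    have h2 := (mem_partialRoutes.1 hR').notMem (mem_rowBoxes.1 hb')
    have h3 := (mem_partialRoutes.1 hR').notMem (mem_rowBoxes.1 hb)
    simp only at heq h1 h2 h3
    have hbb : b = b' := by
      have : b ∈ insert b' R' := heq ▸ Finset.mem_insert_self b R
      exact (Finset.mem_insert.1 this).resolve_right h3
    subst hbb
    rw [← Finset.erase_insert h1, ← Finset.erase_insert h2, heq]
  · intro R hR
    obtain ⟨h, b, hb, hbs⟩ := mem_routes.1 hR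
    refine ⟨(R.erase b, b), Finset.mem_coe.2 (Finset.mem_product.2 ⟨mem_partialRoutes.2 ?_,
      mem_rowBoxes.2 hbs⟩), Finset.insert_erase hb⟩
    refine ⟨?_, ?_, ?_⟩
    · intro c hc
      obtain ⟨hcb, hc⟩ := Finset.mem_erase.1 hc
      have := h.lt c hc
      have : c.val.1 ≠ s := fun hs => hcb (h.one_per_row c hc b hb (hs.trans hbs.symm))
      omega
    · intro c hc c' hc'
      exact h.one_per_row c (Finset.mem_of_mem_erase hc) c' (Finset.mem_of_mem_erase hc')
    · intro c hc r' hr hr' hw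
      obtain ⟨b', hb', h'⟩ := h.no_skip c (Finset.mem_of_mem_erase hc) r' hr (by omega) hw
      exact ⟨b', Finset.mem_erase.2 ⟨fun e => by subst e; omega, hb'⟩, h'⟩

lemma sum_partialRoutes {M : Type*} [AddCommMonoid M] (hanti : Antitone (rowWidth K)) (s : ℕ)
    (G : Finset (BoxOf K) → M) :
    ∑ R ∈ partialRoutes K s, G R =
      G ∅ + ∑ t ∈ Finset.range s, if rowWidth K (t + 1) ≠ rowWidth K t ∨ t + 1 = s then
        ∑ R ∈ routes K t, G R else 0 := by
  have h0 : ∅ ∈ partialRoutes K s := mem_partialRoutes.2 ⟨by simp, by simp, by simp⟩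
  rw [← Finset.add_sum_erase _ _ h0]
  congr 1
  rw [← Finset.sum_fiberwise_of_maps_to (t := Finset.range s)
    (g := fun R : Finset (BoxOf K) => R.sup fun b => b.val.1)]
  · refine Finset.sum_congr rfl fun t ht => ?_
    rw [Finset.mem_range] at ht
    have hmax : ∀ R ∈ (partialRoutes K s).erase ∅, (R.sup fun b => b.val.1) = t →
        ∃ b ∈ R, b.val.1 = t := by
      intro R hR hsup
      obtain ⟨b, hb, hbt⟩ := Finset.exists_mem_eq_sup R
        (Finset.nonempty_iff_ne_empty.2 (Finset.mem_erase.1 hR).1) fun b => b.val.1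
      exact ⟨b, hb, hbt.symm.trans hsup⟩
    split_ifs with hal
    · refine Finset.sum_congr ?_ fun _ _ => rfl
      ext R
      rw [Finset.mem_filter, mem_routes]
      constructor
      · rintro ⟨hR, hsup⟩
        have h := mem_partialRoutes.1 (Finset.mem_of_mem_erase hR)
        refine ⟨⟨fun b hb => ?_, h.one_per_row, fun b hb r' hr hr' => h.no_skip b hb r' hr
          (by omega)⟩, hmax R hR hsup⟩
        rw [Nat.lt_succ_iff, ← hsup]
        exact Finset.le_sup (f := fun b : BoxOf K => b.val.1) hb
      · rintro ⟨h, b, hb, hbt⟩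
        refine ⟨Finset.mem_erase.2 ⟨Finset.ne_empty_of_mem hb, mem_partialRoutes.2
          ⟨fun c hc => by have := h.lt c hc; omega, h.one_per_row,
            fun c hc r' hr hr' hw => ?_⟩⟩, ?_⟩
        · rcases le_or_gt r' t with hrt | hrt
          · exact h.no_skip c hc r' hr (by omega) hw
          · exfalso
            have h1 := hanti (show t + 1 ≤ r' from hrt)
            have h2 := hanti (Nat.lt_succ_iff.1 (h.lt c hc))
            have h3 := hanti (Nat.le_succ t)
            simp only [Nat.succ_eq_add_one] at h3
            rcases hal with hal | hal <;> omega
        · refine le_antisymm (Finset.sup_le fun c hc => Nat.lt_succ_iff.1 (h.lt c hc)) ?_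
          rw [← hbt]
          exact Finset.le_sup (f := fun b : BoxOf K => b.val.1) hb
    · refine Finset.sum_eq_zero fun R hR => ?_
      exfalso
      obtain ⟨hR, hsup⟩ := Finset.mem_filter.1 hR
      obtain ⟨b, hb, hbt⟩ := hmax R hR hsup
      push Not at hal
      obtain ⟨b', hb', hbt'⟩ := (mem_partialRoutes.1 (Finset.mem_of_mem_erase hR)).no_skip b hb
        (t + 1) (by omega) (by omega) (by rw [hbt]; exact hal.1)
      have := Finset.le_sup (f := fun b : BoxOf K => b.val.1) hb'
      omega
  · intro R hR
    obtain ⟨hne, hR⟩ := Finset.mem_erase.1 hR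
    obtain ⟨b, hb, hbt⟩ := Finset.exists_mem_eq_sup R
      (Finset.nonempty_iff_ne_empty.2 hne) fun b => b.val.1
    rw [Finset.mem_range, hbt]
    exact (mem_partialRoutes.1 hR).lt b hb

variable {n : ℕ}

/-- The boxes of `R` in rows strictly above the box `c`. -/
def above (R : Finset (BoxOf K)) (c : BoxOf K) : Finset (BoxOf K) :=
  R.filter fun b => b.val.1 < c.val.1

open MvPolynomial in
/-- The contribution of the box `c` after moving entries along the route `R`, the entry leaving
the shape being required to be `a`. -/
def routeFactor (a : Fin n) (R : Finset (BoxOf K)) (T : Tab K n) (c : BoxOf K) : RowPoly n :=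
  if c ∈ R then
    if above R c = ∅ then C (if T c = a then 1 else 0)
    else X ((above R c).sup fun b => b.val.1, T c)
  else X (c.val.1, T c)

/-- The monomial obtained by moving entries along the route `R`, the entry leaving the shape
being required to be `a`. -/
def routeTerm (a : Fin n) (R : Finset (BoxOf K)) (T : Tab K n) : RowPoly n :=
  ∏ c, routeFactor a R T c

lemma routeTerm_empty (a : Fin n) (T : Tab K n) : routeTerm a ∅ T = rowMon (boxRow K) T := by
  simp [routeTerm, routeFactor, rowMon]

lemma derivation_routeTerm (a : Fin n) {s : ℕ} {R : Finset (BoxOf K)}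
    (hR : ∀ b ∈ R, b.val.1 < s) (T : Tab K n) (d : Derivation ℂ (RowPoly n) (RowPoly n))
    (hd : ∀ c, d (routeFactor a R T c) =
      if c.val.1 = s then routeFactor a (insert c R) T c else 0) :
    d (routeTerm a R T) = ∑ b ∈ rowBoxes K s, routeTerm a (insert b R) T := by
  rw [routeTerm, derivation_prod, rowBoxes, Finset.sum_filter]
  refine Finset.sum_congr rfl fun c _ => ?_
  rw [hd]
  split_ifs with hc
  · rw [routeTerm, ← Finset.mul_prod_erase _ _ (Finset.mem_univ c)]
    congr 1
    refine Finset.prod_congr rfl fun b hb => ?_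
    have hbc := Finset.ne_of_mem_erase hb
    by_cases hbR : b ∈ R
    · have : above (insert c R) b = above R b := by
        rw [above, Finset.filter_insert, if_neg]
        · rfl
        · have := hR b hbR; omega
      simp [routeFactor, hbR, this]
    · simp [routeFactor, hbR, hbc]
  · rw [zero_mul]

lemma above_insert_self {s : ℕ} {R : Finset (BoxOf K)} (hR : ∀ b ∈ R, b.val.1 < s)
    {c : BoxOf K} (hc : c.val.1 = s) : above (insert c R) c = R := by
  rw [above, Finset.filter_insert, if_neg (lt_irrefl _), Finset.filter_true_of_mem]
  exact fun b hb => hc ▸ hR b hb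

open MvPolynomial in
lemma rowDeriv_rowMon (a : Fin n) (s : ℕ) (T : Tab K n) :
    rowDeriv a s (rowMon (boxRow K) T) = ∑ b ∈ rowBoxes K s, routeTerm a (insert b ∅) T := by
  rw [← routeTerm_empty a]
  refine derivation_routeTerm a (by simp) T _ fun c => ?_
  by_cases hc : c.val.1 = s
  · have h2 : above {c} c = ∅ := above_insert_self (R := ∅) (by simp) hc
    simp [routeFactor, hc, h2, pderiv_X, Pi.single_apply]
  · simp [routeFactor, hc, pderiv_X]

open MvPolynomial in
lemma pol_routeTerm (a : Fin n) {s t : ℕ} (hts : t < s) {R : Finset (BoxOf K)}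
    (hR : R ∈ routes K t) (T : Tab K n) :
    pol n t s (routeTerm a R T) = ∑ b ∈ rowBoxes K s, routeTerm a (insert b R) T := by
  obtain ⟨h, b, hb, hbt⟩ := mem_routes.1 hR
  have hlt : ∀ b ∈ R, b.val.1 < s := fun b hb => by have := h.lt b hb; omega
  refine derivation_routeTerm a hlt T _ fun c => ?_
  by_cases hcR : c ∈ R
  · have hcs := (hlt c hcR).ne
    rw [if_neg hcs, routeFactor, if_pos hcR]
    split_ifs with h1 h2
    · simp
    · simp
    · rw [polDer_X, if_neg]
      obtain ⟨d, hd, hdt⟩ := Finset.exists_mem_eq_sup _ (Finset.nonempty_iff_ne_empty.2 h1)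
        fun b : BoxOf K => b.val.1
      rw [hdt]
      exact (hlt d (Finset.mem_of_mem_filter d hd)).ne
  · rw [routeFactor, if_neg hcR, polDer_X]
    simp only
    by_cases hcs : c.val.1 = s
    · rw [if_pos hcs, if_pos hcs, routeFactor, if_pos (Finset.mem_insert_self _ _),
        above_insert_self hlt hcs, if_neg (Finset.ne_empty_of_mem hb)]
      congr 2
      refine le_antisymm ?_ (Finset.sup_le fun d hd => Nat.lt_succ_iff.1 (h.lt d hd))
      rw [← hbt]
      exact Finset.le_sup (f := fun b : BoxOf K => b.val.1) hb
    · rw [if_neg hcs, if_neg hcs]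

/-- The weight of a row in the coefficient of a route. -/
def rowWeight (H lam : ℕ → ℂ) (t : ℕ) : ℂ := if lam (t + 1) ≠ lam t then (H t)⁻¹ else 1

/-- The chain of polarization operators, expanded as a sum over routes. -/
lemma chain_rowMon (hanti : Antitone (rowWidth K)) (a : Fin n) (H : ℕ → ℂ) (T : Tab K n)
    (s : ℕ) : chain (pol n) (rowDeriv a) (blockCoeff H (widths K)) s (rowMon (boxRow K) T) =
      ∑ R ∈ routes K s,
        (∏ b ∈ R.filter (fun b => b.val.1 ≠ s), -rowWeight H (widths K) b.val.1) •
          routeTerm a R T := by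
  induction s using Nat.strong_induction_on with
  | _ s ih =>
    have hfil : ∀ R ∈ partialRoutes K s, ∀ b ∈ rowBoxes K s,
        (insert b R).filter (fun b => b.val.1 ≠ s) = R := by
      intro R hR b hb
      rw [Finset.filter_insert, if_neg (not_not.2 (mem_rowBoxes.1 hb)), Finset.filter_true_of_mem]
      exact fun c hc => ((mem_partialRoutes.1 hR).lt c hc).ne
    rw [sum_routes]
    have h1 : ∀ R ∈ partialRoutes K s, (∑ b ∈ rowBoxes K s,
        (∏ c ∈ (insert b R).filter (fun b => b.val.1 ≠ s), -rowWeight H (widths K) c.val.1) •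
          routeTerm a (insert b R) T) =
        (∏ c ∈ R, -rowWeight H (widths K) c.val.1) •
          ∑ b ∈ rowBoxes K s, routeTerm a (insert b R) T := by
      intro R hR
      rw [Finset.smul_sum]
      exact Finset.sum_congr rfl fun b hb => by rw [hfil R hR b hb]
    rw [Finset.sum_congr rfl h1, sum_partialRoutes hanti, chain_apply, sub_eq_add_neg,
      ← Finset.sum_neg_distrib]
    congr 1
    · rw [rowDeriv_rowMon]
      simp
    · refine Finset.sum_congr rfl fun t ht => ?_
      rw [Finset.mem_range] at ht
      have hcoef : blockCoeff H (widths K) s t =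
          if rowWidth K (t + 1) ≠ rowWidth K t ∨ t + 1 = s then rowWeight H (widths K) t
          else 0 := by
        simp only [blockCoeff, rowWeight, widths, Nat.cast_inj, ne_eq]
        split_ifs <;> tauto
      rw [ih t ht, hcoef, map_sum]
      split_ifs with hal
      · rw [Finset.smul_sum, ← Finset.sum_neg_distrib]
        refine Finset.sum_congr rfl fun R hR => ?_
        rw [map_smul, pol_routeTerm a ht hR, smul_smul, ← neg_smul]
        congr 1
        obtain ⟨h, b, hb, hbt⟩ := mem_routes.1 hR
        have : R.filter (fun b => b.val.1 ≠ t) = R.erase b := by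
          ext c
          rw [Finset.mem_filter, Finset.mem_erase, and_comm]
          refine and_congr_left fun hc => not_congr ⟨fun hct => ?_, fun e => e ▸ hbt⟩
          exact h.one_per_row c hc b hb (hct.trans hbt.symm)
        rw [this, ← Finset.mul_prod_erase _ _ hb, hbt]
        ring
      · rw [zero_smul, neg_zero]

end Routes

/-! ### Shapes with one removable box -/

section Shape

variable {K : Finset Cell}

lemma rowWidth_eq_rowLen (hK : IsLowerSet (K : Set Cell)) (i : ℕ) :
    rowWidth K i = (⟨K, hK⟩ : YoungDiagram).rowLen i :=
  ((⟨K, hK⟩ : YoungDiagram).rowLen_eq_card).symm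

lemma rowWidth_antitone (hK : IsLowerSet (K : Set Cell)) : Antitone (rowWidth K) := by
  intro i j hij
  rw [rowWidth_eq_rowLen hK, rowWidth_eq_rowLen hK]
  exact YoungDiagram.rowLen_anti _ _ _ hij

lemma mem_rowsOf {ρ : ℕ} : ρ ∈ rowsOf K ↔ 0 < rowWidth K ρ := by
  rw [rowsOf, rowWidth, Finset.card_pos, Finset.mem_image]
  constructor
  · rintro ⟨c, hc, rfl⟩
    exact ⟨c, Finset.mem_filter.2 ⟨hc, rfl⟩⟩
  · rintro ⟨c, hc⟩
    exact ⟨c, (Finset.mem_filter.1 hc).1, (Finset.mem_filter.1 hc).2⟩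

lemma kept_eq_erase (X : RemovalOn K 1) : X.kept = K.erase (X.box 0) := by
  ext c
  simp [keptUpTo, and_comm]

lemma rowWidth_kept (X : RemovalOn K 1) (i : ℕ) :
    rowWidth X.kept i + (if i = (X.box 0).1 then 1 else 0) = rowWidth K i := by
  rw [rowWidth, rowWidth, kept_eq_erase, Finset.filter_erase]
  split_ifs with h
  · exact Finset.card_erase_add_one (Finset.mem_filter.2 ⟨X.mem 0, h.symm⟩)
  · rw [Finset.erase_eq_of_notMem, add_zero]
    exact fun hm => h (Finset.mem_filter.1 hm).2.symm

lemma widths_kept (X : RemovalOn K 1) : widths X.kept = widths K - eps (X.box 0).1 := by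
  funext i
  rw [Pi.sub_apply, eq_sub_iff_add_eq, widths, widths, ← rowWidth_kept X i, eps,
    Pi.single_apply]
  push_cast
  rfl

lemma rowWidth_succ_lt (X : RemovalOn K 1) :
    rowWidth K ((X.box 0).1 + 1) < rowWidth K (X.box 0).1 := by
  have h1 := rowWidth_kept X (X.box 0).1
  have h2 := rowWidth_kept X ((X.box 0).1 + 1)
  have h3 := rowWidth_antitone X.lower (Nat.le_succ (X.box 0).1)
  rw [if_pos rfl] at h1
  rw [if_neg (by omega)] at h2
  change rowWidth X.kept ((X.box 0).1 + 1) ≤ rowWidth X.kept (X.box 0).1 at h3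
  omega

/-- Hook lengths measured from row `r`. -/
def hookLen (K : Finset Cell) (r : ℕ) : ℕ → ℂ := fun t =>
  widths K t - widths K r + ((r : ℂ) - t)

lemma hookLen_succ (r q : ℕ) :
    hookLen K r q = hookLen K r (q + 1) + widths K q - widths K (q + 1) + 1 := by
  simp only [hookLen]
  push_cast
  ring

lemma hookLen_self (r : ℕ) : hookLen K r r = 0 := by simp [hookLen]

lemma hookLen_ne_zero (hanti : Antitone (rowWidth K)) {r t : ℕ} (h : t < r) :
    hookLen K r t ≠ 0 := by
  have h1 := hanti h.le
  have : hookLen K r t = ((rowWidth K t - rowWidth K r + (r - t) : ℕ) : ℂ) := by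
    rw [Nat.cast_add, Nat.cast_sub h1, Nat.cast_sub h.le]
    rfl
  rw [this, Nat.cast_ne_zero]
  omega

lemma HW_eq_hookLen (hanti : Antitone (rowWidth K)) {r t : ℕ} (htr : t < r)
    (hr : rowWidth K (r + 1) < rowWidth K r) (ht : rowWidth K (t + 1) ≠ rowWidth K t) :
    ((HW K r (rowWidth K t) : ℤ) : ℂ) = hookLen K r t := by
  have hset : ((rowsOf K).filter fun ρ => rowWidth K r ≤ rowWidth K ρ ∧
      rowWidth K ρ < rowWidth K t) = Finset.Ioc t r := by
    ext ρ
    rw [Finset.mem_filter, mem_rowsOf, Finset.mem_Ioc]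
    constructor
    · rintro ⟨-, h1, h2⟩
      constructor
      · by_contra h
        have := hanti (not_lt.1 h)
        omega
      · by_contra h
        have := hanti (show r + 1 ≤ ρ by omega)
        omega
    · rintro ⟨h1, h2⟩
      have h3 := hanti h2
      have h4 := hanti (show t + 1 ≤ ρ from h1)
      have h5 := hanti (Nat.le_succ t)
      simp only [Nat.succ_eq_add_one] at h5
      omega
  rw [HW, hset, Nat.card_Ioc, hookLen, widths, widths, Nat.cast_sub htr.le]
  push_cast
  ring

lemma coeff1_eq (hanti : Antitone (rowWidth K)) {r : ℕ}
    (hr : rowWidth K (r + 1) < rowWidth K r) {R : Finset (BoxOf K)} (hR : R ∈ routes K r) :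
    coeff1 K r R = -∏ b ∈ R.filter (fun b => b.val.1 ≠ r),
      -rowWeight (hookLen K r) (widths K) b.val.1 := by
  obtain ⟨h, b, hb, hbr⟩ := mem_routes.1 hR
  have hcard : R.card = (R.filter fun b => b.val.1 ≠ r).card + 1 := by
    have : R.filter (fun b => b.val.1 ≠ r) = R.erase b := by
      ext c
      rw [Finset.mem_filter, Finset.mem_erase, and_comm]
      refine and_congr_left fun hc => not_congr ⟨fun hct => ?_, fun e => e ▸ hbr⟩
      exact h.one_per_row c hc b hb (hct.trans hbr.symm)
    rw [this, Finset.card_erase_add_one hb]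
  have hprod : ((HP1 K r R : ℤ) : ℂ) = ∏ b ∈ (R.filter (fun b => b.val.1 ≠ r)).filter
      (fun b => rowWidth K (b.val.1 + 1) ≠ rowWidth K b.val.1), hookLen K r b.val.1 := by
    rw [HP1]
    push_cast
    symm
    refine Finset.prod_nbij (fun b => rowWidth K b.val.1) ?_ ?_ ?_ ?_
    · intro c hc
      simp only [Finset.mem_filter, Finset.mem_image] at hc ⊢
      obtain ⟨⟨hc, hcr⟩, hcw⟩ := hc
      have h1 := h.lt c hc
      have h2 := hanti (show c.val.1 + 1 ≤ r by omega)
      have h3 := hanti (Nat.le_succ c.val.1)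
      simp only [Nat.succ_eq_add_one] at h3
      exact ⟨⟨c, hc, rfl⟩, by omega⟩
    · intro c hc d hd hcd
      simp only [Finset.coe_filter, Finset.mem_filter, Set.mem_ofPred_eq] at hc hd hcd
      refine h.one_per_row c hc.1.1 d hd.1.1 ?_
      have hcw := hanti (Nat.le_succ c.val.1)
      have hdw := hanti (Nat.le_succ d.val.1)
      simp only [Nat.succ_eq_add_one] at hcw hdw
      by_contra hne
      rcases lt_or_gt_of_ne hne with hlt | hlt
      · have := hanti (show c.val.1 + 1 ≤ d.val.1 from hlt)
        omega
      · have := hanti (show d.val.1 + 1 ≤ c.val.1 from hlt)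
        omega
    · intro w hw
      simp only [Finset.coe_filter, Finset.mem_image, Set.mem_ofPred_eq] at hw
      obtain ⟨⟨c, hc, rfl⟩, hwr⟩ := hw
      obtain ⟨d, hd, hmax⟩ := Finset.exists_max_image
        (R.filter fun d => rowWidth K d.val.1 = rowWidth K c.val.1) (fun d => d.val.1)
        ⟨c, Finset.mem_filter.2 ⟨hc, rfl⟩⟩
      obtain ⟨hdR, hdw⟩ := Finset.mem_filter.1 hd
      have hdr : d.val.1 ≠ r := fun e => by rw [e] at hdw; omega
      refine ⟨d, ?_, hdw⟩
      simp only [Finset.coe_filter, Finset.mem_filter, Set.mem_ofPred_eq]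
      refine ⟨⟨hdR, hdr⟩, fun he => ?_⟩
      have := h.lt d hdR
      obtain ⟨e, heR, hed⟩ := h.no_skip d hdR (d.val.1 + 1) (by omega) (by omega) he
      have := hmax e (Finset.mem_filter.2 ⟨heR, by rw [hed, he, hdw]⟩)
      omega
    · intro c hc
      simp only [Finset.mem_filter] at hc
      have := h.lt c hc.1.1
      exact (HW_eq_hookLen hanti (by omega) hr hc.2).symm
  have hw : ∀ t, rowWeight (hookLen K r) (widths K) t =
      if rowWidth K (t + 1) ≠ rowWidth K t then (hookLen K r t)⁻¹ else 1 := by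
    intro t
    simp only [rowWeight, widths, ne_eq, Nat.cast_inj]
  rw [coeff1, hprod, hcard, Finset.prod_neg, pow_succ]
  simp only [hw]
  rw [← Finset.prod_filter, Finset.prod_inv_distrib]
  ring

end Shape

/-! ### One-box paths are determined by their routes -/

section Paths

variable {K : Finset Cell}

/-- The box removed by a one-box removal datum. -/
def RemovalOn.source (X : RemovalOn K 1) : BoxOf K := ⟨X.box 0, X.mem 0⟩

lemma RemovalOn.source_row (X : RemovalOn K 1) : X.source.val.1 = (X.box 0).1 := rfl

/-- `c` is the box of `R` nearest to `b` among those strictly above `b`. -/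
def NextUp (R : Finset (BoxOf K)) (b c : BoxOf K) : Prop :=
  c ∈ R ∧ c.val.1 < b.val.1 ∧ ∀ d ∈ R, d.val.1 < b.val.1 → d.val.1 ≤ c.val.1

lemma above_eq_empty_iff {R : Finset (BoxOf K)} {b : BoxOf K} :
    above R b = ∅ ↔ ∀ d ∈ R, ¬ d.val.1 < b.val.1 := by
  rw [above, Finset.filter_eq_empty_iff]

lemma exists_nextUp {R : Finset (BoxOf K)} {b : BoxOf K} (h : above R b ≠ ∅) :
    ∃ c, NextUp R b c := by
  obtain ⟨c, hc, hmax⟩ := Finset.exists_max_image (above R b) (fun d => d.val.1)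
    (Finset.nonempty_iff_ne_empty.2 h)
  rw [above, Finset.mem_filter] at hc
  exact ⟨c, hc.1, hc.2, fun d hd hdb => hmax d (Finset.mem_filter.2 ⟨hd, hdb⟩)⟩

lemma NextUp.sup_above {R : Finset (BoxOf K)} {b c : BoxOf K} (h : NextUp R b c) :
    ((above R b).sup fun d => d.val.1) = c.val.1 := by
  apply le_antisymm
  · refine Finset.sup_le fun d hd => ?_
    rw [above, Finset.mem_filter] at hd
    exact h.2.2 d hd.1 hd.2
  · exact Finset.le_sup (f := fun d : BoxOf K => d.val.1)
      (Finset.mem_filter.2 ⟨h.1, h.2.1⟩ : c ∈ above R b)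

lemma NextUp.above_ne {R : Finset (BoxOf K)} {b c : BoxOf K} (h : NextUp R b c) :
    above R b ≠ ∅ := fun e => above_eq_empty_iff.1 e c h.1 h.2.1

/-- `P` moves each box of `R` to the next one above it, the topmost one to the extra box, and
the removed box onto the route. -/
structure FollowsRoute (X : RemovalOn K 1) (R : Finset (BoxOf K)) (P : PB K 1 → PB K 1) :
    Prop where
  next : ∀ b ∈ R, ∀ c, NextUp R b c → P (Sum.inl b) = Sum.inl c
  last : ∀ b ∈ R, above R b = ∅ → P (Sum.inl b) = Sum.inr 0
  enter : X.source ∉ R → ∀ c ∈ R, c.val.1 = (X.box 0).1 → P (Sum.inl X.source) = Sum.inl c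
  fix : ∀ b, b ∉ R → b ≠ X.source → P (Sum.inl b) = Sum.inl b
  fix_extra : ∀ i, P (Sum.inr i) = Sum.inr i

lemma FollowsRoute.unique {X : RemovalOn K 1} {R : Finset (BoxOf K)} {P Q : PB K 1 → PB K 1}
    (hR : R ∈ routes K (X.box 0).1) (hP : FollowsRoute X R P) (hQ : FollowsRoute X R Q) :
    P = Q := by
  funext z
  rcases z with b | i
  · by_cases hb : b ∈ R
    · by_cases ha : above R b = ∅
      · rw [hP.last b hb ha, hQ.last b hb ha]
      · obtain ⟨c, hc⟩ := exists_nextUp ha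
        rw [hP.next b hb c hc, hQ.next b hb c hc]
    · by_cases hx : b = X.source
      · subst hx
        obtain ⟨-, c, hc, hcr⟩ := mem_routes.1 hR
        rw [hP.enter hb c hc hcr, hQ.enter hb c hc hcr]
      · rw [hP.fix b hb hx, hQ.fix b hb hx]
  · rw [hP.fix_extra, hQ.fix_extra]

/-- The path with a given route. -/
def pathMap (X : RemovalOn K 1) (R : Finset (BoxOf K)) : PB K 1 → PB K 1
  | Sum.inr i => Sum.inr i
  | Sum.inl b =>
    if b ∈ R then
      if h : ∃ c, NextUp R b c then Sum.inl h.choose else Sum.inr 0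
    else if b = X.source then
      if h : ∃ c ∈ R, c.val.1 = (X.box 0).1 then Sum.inl h.choose else Sum.inl b
    else Sum.inl b

lemma followsRoute_pathMap (X : RemovalOn K 1) {R : Finset (BoxOf K)}
    (hR : R ∈ routes K (X.box 0).1) : FollowsRoute X R (pathMap X R) where
  next b hb c hc := by
    have hex : ∃ c, NextUp R b c := ⟨c, hc⟩
    simp only [pathMap, if_pos hb, dif_pos hex]
    have h1 := hex.choose_spec
    have h2 := h1.2.2 c hc.1 hc.2.1
    have h3 := hc.2.2 _ h1.1 h1.2.1
    rw [(mem_routes.1 hR).1.one_per_row _ h1.1 c hc.1 (le_antisymm h3 h2)]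
  last b hb ha := by
    have hex : ¬ ∃ c, NextUp R b c := fun ⟨c, hc⟩ => hc.above_ne ha
    simp only [pathMap, if_pos hb, dif_neg hex]
  enter hx c hc hcr := by
    have hex : ∃ c ∈ R, c.val.1 = (X.box 0).1 := ⟨c, hc, hcr⟩
    simp only [pathMap, if_neg hx, if_true, dif_pos hex]
    have h1 := hex.choose_spec
    rw [(mem_routes.1 hR).1.one_per_row _ h1.1 c hc (h1.2.trans hcr.symm)]
  fix b hb hx := by simp only [pathMap, if_neg hb, if_neg hx]
  fix_extra i := rfl

lemma lowVal_iterate_le {m : ℕ} {P : PB K m → PB K m} (hP : ∀ z, lowVal (P z) ≤ lowVal z)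
    (j : ℕ) (z : PB K m) : lowVal (P^[j] z) ≤ lowVal z := by
  induction j generalizing z with
  | zero => exact le_rfl
  | succ j ih => exact (ih (P z)).trans (hP z)

section OfPath

variable {X : RemovalOn K 1} {P : PB K 1 → PB K 1} {R : Finset (BoxOf K)}

lemma IsMPath.mem_orb (h : IsMPath X P R) {b : BoxOf K} (hb : b ∈ R) :
    ∃ j : ℕ, P^[j] (Sum.inl X.source) = Sum.inl b := by
  have : (Sum.inl b : PB K 1) ∈ ⋃ i, orb X P i := by
    rw [h.orb_union]
    exact Or.inl ⟨b, hb, rfl⟩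
  obtain ⟨i, hi⟩ := Set.mem_iUnion.1 this
  rw [Subsingleton.elim i 0] at hi
  exact hi

lemma IsMPath.row_le (h : IsMPath X P R) {b : BoxOf K} (hb : b ∈ R) :
    b.val.1 ≤ (X.box 0).1 := by
  obtain ⟨j, hj⟩ := h.mem_orb hb
  have := lowVal_iterate_le h.mono j (Sum.inl X.source)
  rw [hj] at this
  exact Int.ofNat_le.1 this

lemma IsMPath.mem_routes (h : IsMPath X P R) : R ∈ routes K (X.box 0).1 :=
  PieriPaper.mem_routes.2 ⟨⟨fun _ hb => Nat.lt_succ_of_le (h.row_le hb), h.route.one_per_row,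
    fun b hb r' h1 _ h2 => h.route.no_skip b hb r' h1 h2⟩, h.route.start⟩

lemma IsMPath.apply_route (h : IsMPath X P R) {b : BoxOf K} (hb : b ∈ R ∨ b = X.source) :
    (∃ c ∈ R, P (Sum.inl b) = Sum.inl c) ∨ P (Sum.inl b) = Sum.inr 0 := by
  have : P (Sum.inl b) ∈ (fun b : BoxOf K => P (Sum.inl b)) ''
      {b : BoxOf K | b ∈ R ∨ ∃ i, b.val = X.box i} :=
    ⟨b, hb.imp id fun e => ⟨0, congrArg Subtype.val e⟩, rfl⟩
  rw [h.image_route] at this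
  rcases this with ⟨c, hc, hcb⟩ | ⟨i, hi⟩
  · exact Or.inl ⟨c, hc.1, hcb.symm⟩
  · rw [Subsingleton.elim i 0] at hi
    exact Or.inr hi.symm

lemma IsMPath.followsRoute (h : IsMPath X P R) : FollowsRoute X R P where
  next b hb c hc := by
    obtain ⟨i, hi⟩ := h.mem_orb hb
    obtain ⟨j, hj⟩ := h.mem_orb hc.1
    have hlt := hc.2.1
    have hij : i < j := by
      by_contra hij
      have := lowVal_iterate_le h.mono (i - j) (P^[j] (Sum.inl X.source))
      rw [← Function.iterate_add_apply, Nat.sub_add_cancel (not_lt.1 hij), hi, hj] at this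
      simp only [lowVal] at this
      omega
    have hle := lowVal_iterate_le h.mono (j - (i + 1)) (P^[i + 1] (Sum.inl X.source))
    rw [← Function.iterate_add_apply, Nat.sub_add_cancel hij, hj, Function.iterate_succ_apply',
      hi] at hle
    have hs := h.strict_on_route b hb
    rcases h.apply_route (Or.inl hb) with ⟨d, hd, hbd⟩ | hb0
    · rw [hbd] at hle hs ⊢
      simp only [lowVal] at hle hs
      have := hc.2.2 d hd (by omega)
      rw [h.route.one_per_row d hd c hc.1 (by omega)]
    · rw [hb0] at hle
      simp only [lowVal] at hle
      simp at hle
      omega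
  last b hb ha := by
    rcases h.apply_route (Or.inl hb) with ⟨d, hd, hbd⟩ | hb0
    · have hs := h.strict_on_route b hb
      rw [hbd] at hs
      exact absurd (Int.ofNat_lt.1 hs) (above_eq_empty_iff.1 ha d hd)
    · exact hb0
  enter hx c hc hcr := by
    obtain ⟨j, hj⟩ := h.mem_orb hc
    rcases j with _ | j
    · exact absurd (Sum.inl.inj hj ▸ hc) hx
    · have hle := lowVal_iterate_le h.mono j (P (Sum.inl X.source))
      rw [← Function.iterate_succ_apply, hj] at hle
      rcases h.apply_route (Or.inr rfl) with ⟨d, hd, hbd⟩ | hb0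
      · rw [hbd] at hle ⊢
        simp only [lowVal] at hle
        have := h.row_le hd
        rw [h.route.one_per_row d hd c hc (by omega)]
      · rw [hb0] at hle
        simp only [lowVal] at hle
        simp at hle
        omega
  fix b hb hx := h.fix_out b hb fun i e => hx (Subtype.ext (by
    rw [Subsingleton.elim i 0] at e
    exact e))
  fix_extra := h.fix_y

end OfPath

section ToPath

variable {X : RemovalOn K 1} {P : PB K 1 → PB K 1} {R : Finset (BoxOf K)}

lemma FollowsRoute.apply_mem (h : FollowsRoute X R P) {b : BoxOf K} (hb : b ∈ R) :
    (∃ c, NextUp R b c ∧ P (Sum.inl b) = Sum.inl c) ∨ P (Sum.inl b) = Sum.inr 0 := by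
  by_cases ha : above R b = ∅
  · exact Or.inr (h.last b hb ha)
  · obtain ⟨c, hc⟩ := exists_nextUp ha
    exact Or.inl ⟨c, hc, h.next b hb c hc⟩

lemma FollowsRoute.strict (h : FollowsRoute X R P) {b : BoxOf K} (hb : b ∈ R) :
    lowVal (P (Sum.inl b)) < (b.val.1 : ℤ) := by
  rcases h.apply_mem hb with ⟨c, hc, e⟩ | e
  · rw [e]
    exact Int.ofNat_lt.2 hc.2.1
  · rw [e]
    simp only [lowVal]
    simp
    omega

lemma FollowsRoute.mono (h : FollowsRoute X R P) (hR : R ∈ routes K (X.box 0).1)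
    (z : PB K 1) : lowVal (P z) ≤ lowVal z := by
  rcases z with b | i
  · by_cases hb : b ∈ R
    · exact (h.strict hb).le
    · by_cases hx : b = X.source
      · subst hx
        obtain ⟨-, c, hc, hcr⟩ := mem_routes.1 hR
        rw [h.enter hb c hc hcr]
        simp only [lowVal, hcr, X.source_row, le_refl]
      · rw [h.fix b hb hx]
  · rw [h.fix_extra]

lemma FollowsRoute.exists_preimage (h : FollowsRoute X R P) (hR : R ∈ routes K (X.box 0).1)
    {b : BoxOf K} (hb : b ∈ R) (hx : b ≠ X.source) :
    ∃ d, (d ∈ R ∨ d = X.source) ∧ P (Sum.inl d) = Sum.inl b ∧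
      (d ∈ R → b.val.1 < d.val.1 ∧ d.val.1 ≤ (X.box 0).1) := by
  obtain ⟨hp, s, hs, hsr⟩ := mem_routes.1 hR
  by_cases hbr : b.val.1 = (X.box 0).1
  · have hxR : X.source ∉ R := fun hxR => hx (hp.one_per_row b hb _ hxR hbr)
    exact ⟨X.source, Or.inr rfl, h.enter hxR b hb hbr, fun hxR' => absurd hxR' hxR⟩
  · have hlt := hp.lt b hb
    obtain ⟨d, hd, hmin⟩ := Finset.exists_min_image (R.filter fun d => b.val.1 < d.val.1)
      (fun d => d.val.1) ⟨s, Finset.mem_filter.2 ⟨hs, by omega⟩⟩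
    obtain ⟨hdR, hbd⟩ := Finset.mem_filter.1 hd
    refine ⟨d, Or.inl hdR, h.next d hdR b ⟨hb, hbd, fun e he hed => ?_⟩, fun _ =>
      ⟨hbd, Nat.lt_succ_iff.1 (hp.lt d hdR)⟩⟩
    by_contra hlt
    have := hmin e (Finset.mem_filter.2 ⟨he, not_le.1 hlt⟩)
    omega

lemma FollowsRoute.mem_orb (h : FollowsRoute X R P) (hR : R ∈ routes K (X.box 0).1)
    {b : BoxOf K} (hb : b ∈ R) : (Sum.inl b : PB K 1) ∈ orb X P 0 := by
  induction hk : (X.box 0).1 - b.val.1 using Nat.strong_induction_on generalizing b with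
  | _ k ih =>
    by_cases hx : b = X.source
    · exact ⟨0, by rw [hx]; rfl⟩
    · obtain ⟨d, hd, hdb, hrow⟩ := h.exists_preimage hR hb hx
      have : (Sum.inl d : PB K 1) ∈ orb X P 0 := by
        by_cases hdR : d ∈ R
        · have := hrow hdR
          exact ih _ (by omega) hdR rfl
        · exact ⟨0, by rw [hd.resolve_left hdR]; rfl⟩
      obtain ⟨j, hj⟩ := this
      exact ⟨j + 1, by rw [Function.iterate_succ_apply', hj, hdb]⟩

lemma FollowsRoute.exists_preimage_extra (h : FollowsRoute X R P)
    (hR : R ∈ routes K (X.box 0).1) : ∃ b ∈ R, P (Sum.inl b) = Sum.inr 0 := by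
  obtain ⟨-, s, hs, -⟩ := mem_routes.1 hR
  obtain ⟨b, hb, hmin⟩ := Finset.exists_min_image R (fun d => d.val.1) ⟨s, hs⟩
  exact ⟨b, hb, h.last b hb (above_eq_empty_iff.2 fun d hd => not_lt.2 (hmin d hd))⟩

lemma FollowsRoute.apply_source (h : FollowsRoute X R P) (hR : R ∈ routes K (X.box 0).1)
    (hx : X.source ∉ R) : ∃ c ∈ R, c.val.1 = (X.box 0).1 ∧ P (Sum.inl X.source) = Sum.inl c := by
  obtain ⟨-, c, hc, hcr⟩ := mem_routes.1 hR
  exact ⟨c, hc, hcr, h.enter hx c hc hcr⟩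

lemma FollowsRoute.orb_eq (h : FollowsRoute X R P) (hR : R ∈ routes K (X.box 0).1) :
    orb X P 0 = {z : PB K 1 | (∃ b ∈ R, z = Sum.inl b) ∨
      (∃ i, z = Sum.inl ⟨X.box i, X.mem i⟩) ∨ ∃ i, z = Sum.inr i} := by
  apply Set.Subset.antisymm
  · rintro z ⟨j, rfl⟩
    induction j with
    | zero => exact Or.inr (Or.inl ⟨0, rfl⟩)
    | succ j ih =>
      have key : ∀ b, (b ∈ R ∨ b = X.source) → P (Sum.inl b) ∈ {z : PB K 1 |
          (∃ b ∈ R, z = Sum.inl b) ∨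
          (∃ i, z = Sum.inl ⟨X.box i, X.mem i⟩) ∨ ∃ i, z = Sum.inr i} := by
        intro b hb
        by_cases hbR : b ∈ R
        · rcases h.apply_mem hbR with ⟨c, hc, e⟩ | e
          · exact Or.inl ⟨c, hc.1, e⟩
          · exact Or.inr (Or.inr ⟨0, e⟩)
        · have hx := hb.resolve_left hbR
          subst hx
          obtain ⟨c, hc, -, e⟩ := h.apply_source hR hbR
          exact Or.inl ⟨c, hc, e⟩
      rw [Function.iterate_succ_apply']
      rcases ih with ⟨b, hb, e⟩ | ⟨i, e⟩ | ⟨i, e⟩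
      · rw [e]
        exact key b (Or.inl hb)
      · rw [e]
        exact key _ (Or.inr (by rw [Subsingleton.elim i 0]; rfl))
      · rw [e, h.fix_extra]
        exact Or.inr (Or.inr ⟨i, rfl⟩)
  · rintro z (⟨b, hb, rfl⟩ | ⟨i, rfl⟩ | ⟨i, rfl⟩)
    · exact h.mem_orb hR hb
    · exact ⟨0, by rw [Subsingleton.elim i 0]; rfl⟩
    · obtain ⟨b, hb, e⟩ := h.exists_preimage_extra hR
      obtain ⟨j, hj⟩ := h.mem_orb hR hb
      exact ⟨j + 1, by rw [Function.iterate_succ_apply', hj, e, Subsingleton.elim i 0]⟩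

lemma no_skip_of_mem_routes (hanti : Antitone (rowWidth K)) {r : ℕ}
    (hr : rowWidth K (r + 1) < rowWidth K r) (hR : R ∈ routes K r) :
    ∀ b ∈ R, ∀ r' : ℕ, b.val.1 < r' → rowWidth K r' = rowWidth K b.val.1 →
      ∃ b' ∈ R, b'.val.1 = r' := by
  obtain ⟨hp, -⟩ := mem_routes.1 hR
  intro b hb r' hlt hw
  refine hp.no_skip b hb r' hlt ?_ hw
  by_contra hge
  have h1 := hanti (not_lt.1 hge)
  have h2 := hanti (Nat.lt_succ_iff.1 (hp.lt b hb))
  omega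

lemma FollowsRoute.isMPath (h : FollowsRoute X R P) (hanti : Antitone (rowWidth K))
    (hR : R ∈ routes K (X.box 0).1) : IsMPath X P R where
  route := ⟨(mem_routes.1 hR).2, (mem_routes.1 hR).1.one_per_row,
    no_skip_of_mem_routes hanti (rowWidth_succ_lt X) hR⟩
  mono := h.mono hR
  strict_on_route _ hb := h.strict hb
  y_mem i := by
    rw [Subsingleton.elim i 0, h.orb_eq hR]
    exact Or.inr (Or.inr ⟨0, rfl⟩)
  orb_union := by
    rw [← h.orb_eq hR]
    exact Set.iUnion_eq_const fun i => by rw [Subsingleton.elim i 0]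
  orb_disjoint i j hij := absurd (Subsingleton.elim i j) hij
  interlace w _ := by
    refine ⟨fun _ => 0, fun i _ j _ _ => Subsingleton.elim i j, fun i hi => ⟨?_, ?_⟩⟩
    · exact (Set.ncard_pos (Set.toFinite _)).2 ⟨i, hi⟩
    · rw [Subsingleton.elim i 0] at hi ⊢
      obtain ⟨c₀, hc₀⟩ := hi
      obtain ⟨c, hc, hmax⟩ := Finset.exists_max_image
        (Finset.univ.filter fun c : BoxOf K => (Sum.inl c : PB K 1) ∈ orb X P 0 ∧
          rowWidth K c.val.1 = w) (fun c => c.val.1)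
        ⟨c₀, Finset.mem_filter.2 ⟨Finset.mem_univ _, hc₀⟩⟩
      obtain ⟨-, hco, hcw⟩ := Finset.mem_filter.1 hc
      refine ⟨c, hco, hcw, Finset.card_eq_zero.2 (Finset.filter_eq_empty_iff.2 ?_)⟩
      rintro ρ - ⟨hcρ, hρ⟩
      by_cases hcR : c ∈ R
      · obtain ⟨b', hb', e⟩ := no_skip_of_mem_routes hanti (rowWidth_succ_lt X) hR c hcR ρ hcρ
          (hρ.trans hcw.symm)
        have := hmax b' (Finset.mem_filter.2 ⟨Finset.mem_univ _, h.mem_orb hR hb', by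
          rw [e, hρ]⟩)
        omega
      · rw [h.orb_eq hR] at hco
        rcases hco with ⟨b, hb, e⟩ | ⟨i, e⟩ | ⟨i, e⟩
        · exact hcR (Sum.inl.inj e ▸ hb)
        · have hc' : c.val = X.box 0 := by
            rw [Sum.inl.inj e, Subsingleton.elim i 0]
          have h1 := rowWidth_succ_lt X
          rw [hc'] at hcρ hcw
          have h2 := hanti (show (X.box 0).1 + 1 ≤ ρ from hcρ)
          omega
        · cases e
  row_order b hb b' hb' c c' _ hlt hbc hbc' _ _ := by
    have h1 := h.strict hb'
    rw [hbc'] at h1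
    rcases h.apply_mem hb with ⟨d, hd, e⟩ | e
    · rw [hbc] at e
      obtain rfl := Sum.inl.inj e
      have h2 := hd.2.2 b' hb' hlt
      simp only [lowVal] at h1
      omega
    · rw [hbc] at e
      cases e
  fix_y := h.fix_extra
  fix_out b hb hx := h.fix b hb fun e => hx 0 (congrArg Subtype.val e)
  image_route := by
    have hmem : ∀ b : BoxOf K, (∃ i, b.val = X.box i) ↔ b = X.source := fun b =>
      ⟨fun ⟨i, e⟩ => Subtype.ext (by rw [Subsingleton.elim i 0] at e; exact e),
        fun e => ⟨0, congrArg Subtype.val e⟩⟩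
    have hmem' : ∀ b : BoxOf K, (∀ i, b.val ≠ X.box i) ↔ b ≠ X.source := fun b => by
      rw [ne_eq, ← hmem b, not_exists]
    simp only [hmem, hmem']
    have hp := (mem_routes.1 hR).1
    apply Set.Subset.antisymm
    · rintro _ ⟨b, hb, rfl⟩
      by_cases hbR : b ∈ R
      · rcases h.apply_mem hbR with ⟨c, hc, e⟩ | e
        · refine Or.inl ⟨c, ⟨hc.1, ?_⟩, e.symm⟩
          rintro rfl
          have := hc.2.1
          have := hp.lt b hbR
          simp only [X.source_row] at *
          omega
        · exact Or.inr ⟨0, e.symm⟩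
      · have hx := hb.resolve_left hbR
        subst hx
        obtain ⟨c, hc, -, e⟩ := h.apply_source hR hbR
        exact Or.inl ⟨c, ⟨hc, fun e => hbR (e ▸ hc)⟩, e.symm⟩
    · rintro _ (⟨b, ⟨hb, hx⟩, rfl⟩ | ⟨i, rfl⟩)
      · obtain ⟨d, hd, e, -⟩ := h.exists_preimage hR hb hx
        exact ⟨d, hd, e⟩
      · obtain ⟨b, hb, e⟩ := h.exists_preimage_extra hR
        exact ⟨b, Or.inl hb, by rw [Subsingleton.elim i 0]; exact e⟩

end ToPath

lemma sum_paths {M : Type*} [AddCommMonoid M] (X : RemovalOn K 1)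
    (hanti : Antitone (rowWidth K)) (f : Finset (BoxOf K) → M) :
    ∑ P : MPath X, f P.route = ∑ R ∈ routes K (X.box 0).1, f R := by
  refine Finset.sum_bij (fun P _ => P.route) (fun P _ => P.2.mem_routes) ?_ ?_ fun _ _ => rfl
  · rintro ⟨⟨P, R⟩, hP⟩ - ⟨⟨Q, R'⟩, hQ⟩ - (rfl : R = R')
    obtain rfl : P = Q := hP.followsRoute.unique hP.mem_routes hQ.followsRoute
    rfl
  · intro R hR
    exact ⟨⟨(pathMap X R, R), (followsRoute_pathMap X hR).isMPath hanti hR⟩,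
      Finset.mem_univ _, rfl⟩

end Paths

/-! ### The one-box removal map on monomials -/

section OneBox

variable {K : Finset Cell} {n : ℕ}

section PathEquiv

variable {X : RemovalOn K 1} {P : PB K 1 → PB K 1} {R : Finset (BoxOf K)}

/-- The boxes of the smaller shape and the extra box, as values of a path. -/
def keptIncl (X : RemovalOn K 1) : BoxOf X.kept ⊕ Unit → PB K 1
  | Sum.inl z => Sum.inl ⟨z.val, kept_subset X z.2⟩
  | Sum.inr _ => Sum.inr 0

lemma keptIncl_injective (X : RemovalOn K 1) : Function.Injective (keptIncl X) := by
  rintro (z | z) (w | w) h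
  · simp only [keptIncl, Sum.inl.injEq, Subtype.mk.injEq] at h
    exact congrArg Sum.inl (Subtype.ext h)
  · cases h
  · cases h
  · rfl

lemma IsMPath.map_pinv (h : IsMPath X P R) (u : BoxOf X.kept ⊕ Unit) :
    P (Sum.inl (pinv X P (keptIncl X u))) = keptIncl X u := by
  have hex : ∃ b : BoxOf K, P (Sum.inl b) = keptIncl X u := by
    rcases u with z | z
    · have hz : ∀ i, z.val ≠ X.box i := fun i => by
        have := (Finset.ext_iff.1 (kept_eq_erase X) z.val).1 z.2
        rw [Subsingleton.elim i 0]
        exact (Finset.mem_erase.1 this).1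
      by_cases hzR : (⟨z.val, kept_subset X z.2⟩ : BoxOf K) ∈ R
      · have hm : keptIncl X (Sum.inl z) ∈ (fun b : BoxOf K => P (Sum.inl b)) ''
            {b : BoxOf K | b ∈ R ∨ ∃ i, b.val = X.box i} := by
          rw [h.image_route]
          exact Or.inl ⟨_, ⟨hzR, hz⟩, rfl⟩
        obtain ⟨b, -, hb⟩ := hm
        exact ⟨b, hb⟩
      · exact ⟨_, h.fix_out _ hzR hz⟩
    · have hm : (Sum.inr 0 : PB K 1) ∈ (fun b : BoxOf K => P (Sum.inl b)) ''
          {b : BoxOf K | b ∈ R ∨ ∃ i, b.val = X.box i} := by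
        rw [h.image_route]
        exact Or.inr ⟨0, rfl⟩
      obtain ⟨b, -, hb⟩ := hm
      exact ⟨b, hb⟩
  exact @Function.invFun_eq (BoxOf K) (PB K 1) ⟨⟨X.box 0, X.mem 0⟩⟩ (fun b => P (Sum.inl b)) _ hex

/-- The inverse of a path, as a bijection onto the boxes of the larger shape. -/
def IsMPath.pathEquiv (h : IsMPath X P R) : BoxOf X.kept ⊕ Unit ≃ BoxOf K :=
  Equiv.ofBijective (fun u => pinv X P (keptIncl X u)) <| by
    rw [Fintype.bijective_iff_injective_and_card]
    constructor
    · intro u v huv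
      apply keptIncl_injective X
      rw [← h.map_pinv u, ← h.map_pinv v]
      exact congrArg (fun b => P (Sum.inl b)) huv
    · rw [Fintype.card_sum, Fintype.card_unit, Fintype.card_coe, Fintype.card_coe,
        kept_eq_erase, Finset.card_erase_add_one (X.mem 0)]

lemma IsMPath.TP_apply (h : IsMPath X P R) (T : Tab K n) (z : BoxOf X.kept) :
    TP X T P z = T (h.pathEquiv (Sum.inl z)) := rfl

lemma IsMPath.alphaP_eq (h : IsMPath X P R) (T : Tab K n) :
    alphaP X T P 0 = T (h.pathEquiv (Sum.inr ())) := rfl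

lemma IsMPath.map_pathEquiv (h : IsMPath X P R) (u : BoxOf X.kept ⊕ Unit) :
    P (Sum.inl (h.pathEquiv u)) = keptIncl X u := h.map_pinv u

lemma FollowsRoute.routeFactor_inl (h : FollowsRoute X R P) (hR : R ∈ routes K (X.box 0).1)
    (a : Fin n) (T : Tab K n) {c d : BoxOf K} (hcd : P (Sum.inl c) = Sum.inl d) :
    routeFactor a R T c = MvPolynomial.X (d.val.1, T c) := by
  rw [routeFactor]
  by_cases hc : c ∈ R
  · rw [if_pos hc]
    by_cases ha : above R c = ∅
    · rw [h.last c hc ha] at hcd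
      cases hcd
    · obtain ⟨e, he⟩ := exists_nextUp ha
      rw [h.next c hc e he] at hcd
      rw [if_neg ha, he.sup_above, Sum.inl.inj hcd]
  · rw [if_neg hc]
    by_cases hx : c = X.source
    · subst hx
      obtain ⟨e, -, her, hce⟩ := h.apply_source hR hc
      rw [hce] at hcd
      rw [← Sum.inl.inj hcd, her, X.source_row]
    · rw [h.fix c hc hx] at hcd
      rw [Sum.inl.inj hcd]

lemma FollowsRoute.routeFactor_inr (h : FollowsRoute X R P) (hR : R ∈ routes K (X.box 0).1)
    (a : Fin n) (T : Tab K n) {c : BoxOf K} (hc0 : P (Sum.inl c) = Sum.inr 0) :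
    routeFactor a R T c = MvPolynomial.C (if T c = a then 1 else 0) := by
  rw [routeFactor]
  by_cases hc : c ∈ R
  · rw [if_pos hc]
    by_cases ha : above R c = ∅
    · rw [if_pos ha]
    · obtain ⟨e, he⟩ := exists_nextUp ha
      rw [h.next c hc e he] at hc0
      cases hc0
  · by_cases hx : c = X.source
    · subst hx
      obtain ⟨e, -, -, hce⟩ := h.apply_source hR hc
      rw [hce] at hc0
      cases hc0
    · rw [h.fix c hc hx] at hc0
      cases hc0

lemma IsMPath.routeTerm_eq (h : IsMPath X P R) (a : Fin n) (T : Tab K n) :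
    routeTerm a R T =
      (if alphaP X T P 0 = a then (1 : ℂ) else 0) • rowMon (boxRow X.kept) (TP X T P) := by
  rw [routeTerm, ← h.pathEquiv.prod_comp, Fintype.prod_sum_type, Fintype.prod_unique (ι := Unit),
    mul_comm,
    h.followsRoute.routeFactor_inr h.mem_routes a T (h.map_pathEquiv (Sum.inr ())),
    MvPolynomial.smul_eq_C_mul, h.alphaP_eq, rowMon]
  congr 1
  refine Finset.prod_congr rfl fun z _ => ?_
  rw [h.followsRoute.routeFactor_inl h.mem_routes a T (h.map_pathEquiv (Sum.inl z)), h.TP_apply]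

end PathEquiv

/-- Contraction of `V ⊗ M` with the coordinate `a` of `V`. -/
def contract {M : Type*} [AddCommGroup M] [Module ℂ M] (a : Fin n) :
    (Fin n → ℂ) ⊗[ℂ] M →ₗ[ℂ] M :=
  TensorProduct.lift ((LinearMap.lsmul ℂ M).comp (LinearMap.proj a))

lemma contract_tmul {M : Type*} [AddCommGroup M] [Module ℂ M] (a : Fin n) (v : Fin n → ℂ)
    (z : M) : contract a (v ⊗ₜ[ℂ] z) = v a • z := by
  simp [contract]

lemma sum_stdv_tmul_contract {M : Type*} [AddCommGroup M] [Module ℂ M]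
    (y : (Fin n → ℂ) ⊗[ℂ] M) : ∑ a, stdv n a ⊗ₜ[ℂ] contract a y = y := by
  induction y using TensorProduct.induction_on with
  | zero => simp
  | tmul v z =>
    simp only [contract_tmul, TensorProduct.tmul_smul, TensorProduct.smul_tmul']
    rw [← TensorProduct.sum_tmul]
    congr 1
    funext i
    simp [stdv, Pi.single_apply]
  | add x y hx hy =>
    simp only [map_add, TensorProduct.tmul_add, Finset.sum_add_distrib, hx, hy]

lemma mem_tensR_of_contract {y : (Fin n → ℂ) ⊗[ℂ] FreeT K n}
    (h : ∀ a, contract a y ∈ Rmod K n) : y ∈ tensR (Fin n → ℂ) K n := by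
  rw [← sum_stdv_tmul_contract y]
  exact Submodule.sum_mem _ fun a _ => Submodule.subset_span ⟨_, _, h a, rfl⟩

lemma monL_contract_Phi1 (X : RemovalOn K 1) (hanti : Antitone (rowWidth K)) (a : Fin n)
    (z : FreeT K n) :
    monL X.kept n (contract a (Phi1 X n z)) =
      -chain (pol n) (rowDeriv a) (blockCoeff (hookLen K (X.box 0).1) (widths K)) (X.box 0).1
        (monL K n z) := by
  induction z using Finsupp.induction_linear with
  | zero => simp
  | add x y hx hy => rw [map_add, map_add, map_add, hx, hy, map_add, map_add, neg_add]
  | single T c =>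
    have hT : monL X.kept n (contract a (Phi1 X n (Finsupp.single T 1))) =
        -chain (pol n) (rowDeriv a) (blockCoeff (hookLen K (X.box 0).1) (widths K)) (X.box 0).1
          (monL K n (Finsupp.single T 1)) := by
      have hPhi : Phi1 X n (Finsupp.single T 1) =
          ∑ P : MPath X, coeff1 K (X.box 0).1 P.route • pact1 X T P.map := by
        simp [Phi1]
      rw [hPhi, monL_single, one_smul, chain_rowMon hanti, map_sum, map_sum,
        ← Finset.sum_neg_distrib]
      trans ∑ R ∈ routes K (X.box 0).1, coeff1 K (X.box 0).1 R • routeTerm a R T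
      · rw [← sum_paths X hanti fun R => coeff1 K (X.box 0).1 R • routeTerm a R T]
        refine Finset.sum_congr rfl fun P _ => ?_
        rw [map_smul, map_smul, pact1, contract_tmul, map_smul, monL_single, one_smul,
          show routeTerm a P.route T = _ from P.2.routeTerm_eq a T, stdv, Pi.single_apply]
        congr 2
        simp only [eq_comm]
        rfl
      · refine Finset.sum_congr rfl fun R hR => ?_
        rw [coeff1_eq hanti (rowWidth_succ_lt X) hR, neg_smul]
    have hc : Finsupp.single T c = c • Finsupp.single T (1 : ℂ) := by simp
    rw [hc]
    simp only [map_smul, hT, smul_neg]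

lemma eps_comm_arith (w : ℕ → ℂ) (r p q : ℕ) :
    w + eps p - eps q - eps r = w - eps r + eps p - eps q := by
  abel

theorem Phi1_mem_tensR (X : RemovalOn K 1) (hK : IsLowerSet (K : Set Cell)) {z : FreeT K n}
    (hz : z ∈ Rmod K n) : Phi1 X n z ∈ tensR (Fin n → ℂ) X.kept n := by
  have hanti := rowWidth_antitone hK
  have hanti' : Antitone (rowWidth X.kept) := rowWidth_antitone X.lower
  refine mem_tensR_of_contract fun a => mem_Rmod_of_monL_mem ?_
  have : Nonempty (Fin n) := ⟨a⟩
  set r := (X.box 0).1 with hr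
  set N := (Rmod X.kept n).map (monL X.kept n) with hN
  have hH := hookLen_succ (K := K) r
  have h0 := fun t (ht : t < r) => hookLen_ne_zero hanti ht
  rw [monL_contract_Phi1 X hanti]
  apply N.neg_mem
  have hfull : lowered (pol n) (widths K) ≤
      N.comap (chain (pol n) (rowDeriv a) (fullCoeff (hookLen K r)) r) := by
    refine iSup_le fun p => ?_
    rintro _ ⟨x, hx, rfl⟩
    rw [Submodule.mem_comap,
      (pol_rel a).fullChain_comm _ (widths K) r p hH h0 (hookLen_self r) hx]
    refine pol_mem_map_Rmod (by omega) (hanti' (Nat.le_succ p)) ?_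
    rw [widths_kept, ← eps_comm_arith]
    exact (pol_rel a).wt_chain hx _ _
  have hmoves : blockMoves (pol n) (widths K) r ≤ N := by
    refine Submodule.span_le.2 ?_
    rintro _ ⟨u, t, x, hut, htr, hw, hx, rfl⟩
    refine pol_mem_map_Rmod hut.ne ?_ ?_
    · have h1 := rowWidth_kept X u
      have h2 := rowWidth_kept X t
      rw [if_neg (by omega)] at h1 h2
      have h3 : rowWidth K u = rowWidth K t := Nat.cast_injective hw
      omega
    · rw [widths_kept]
      exact hx
  have hdiff := hmoves ((pol_rel a).blockChain_sub_fullChain (hookLen K r) (widths K) r hH h0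
    (hookLen_self r) (monL_mem_wtSpace z))
  have := N.add_mem hdiff (hfull (monL_mem_lowered hz))
  rwa [sub_add_cancel] at this

end OneBox

/-! ### Equivariance and iteration -/

section Iteration

variable {n : ℕ}

lemma glAct_single (K : Finset Cell) (g : Matrix (Fin n) (Fin n) ℂ) (T : Tab K n) :
    glAct K n g (Finsupp.single T 1) =
      ∑ T' : Tab K n, (∏ x : BoxOf K, g (T' x) (T x)) • Finsupp.single T' (1 : ℂ) := by
  simp [glAct]

lemma mulVecLin_stdv (g : Matrix (Fin n) (Fin n) ℂ) (i : Fin n) :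
    Matrix.mulVecLin g (stdv n i) = ∑ j, g j i • stdv n j := by
  funext k
  simp [stdv, Pi.single_apply]

/-- Splitting a tableau along a path into the removed entry and the remaining tableau. -/
def IsMPath.tabEquiv {K : Finset Cell} {X : RemovalOn K 1} {P : PB K 1 → PB K 1}
    {R : Finset (BoxOf K)} (h : IsMPath X P R) (n : ℕ) : Tab K n ≃ Tab X.kept n × Fin n :=
  ((h.pathEquiv.symm.arrowCongr (Equiv.refl (Fin n))).trans
    (Equiv.sumArrowEquivProdArrow _ _ _)).trans
    ((Equiv.refl _).prodCongr (Equiv.funUnique Unit (Fin n)))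

lemma IsMPath.tabEquiv_apply {K : Finset Cell} {X : RemovalOn K 1} {P : PB K 1 → PB K 1}
    {R : Finset (BoxOf K)} (h : IsMPath X P R) (T : Tab K n) :
    h.tabEquiv n T = (TP X T P, alphaP X T P 0) := rfl

lemma IsMPath.sum_smul_pact1 {K : Finset Cell} {X : RemovalOn K 1} {P : PB K 1 → PB K 1}
    {R : Finset (BoxOf K)} (h : IsMPath X P R) (g : Matrix (Fin n) (Fin n) ℂ) (T : Tab K n) :
    ∑ T' : Tab K n, (∏ x : BoxOf K, g (T' x) (T x)) • pact1 X T' P =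
      TensorProduct.map (Matrix.mulVecLin g) (glAct X.kept n g) (pact1 X T P) := by
  rw [pact1, TensorProduct.map_tmul, mulVecLin_stdv, glAct_single, TensorProduct.tmul_sum]
  simp only [TensorProduct.sum_tmul]
  rw [← Fintype.sum_prod_type' fun (S : Tab X.kept n) (j : Fin n) =>
    (g j (alphaP X T P 0) • stdv n j) ⊗ₜ[ℂ]
      ((∏ x, g (S x) (TP X T P x)) • Finsupp.single S (1 : ℂ)), ← (h.tabEquiv n).sum_comp]
  refine Finset.sum_congr rfl fun T' _ => ?_
  rw [h.tabEquiv_apply, TensorProduct.smul_tmul_smul, pact1, ← h.pathEquiv.prod_comp,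
    Fintype.prod_sum_type, Fintype.prod_unique (ι := Unit), mul_comm]
  rfl

theorem Phi1_glAct {K : Finset Cell} (X : RemovalOn K 1) (g : Matrix (Fin n) (Fin n) ℂ)
    (z : FreeT K n) : Phi1 X n (glAct K n g z) =
      TensorProduct.map (Matrix.mulVecLin g) (glAct X.kept n g) (Phi1 X n z) := by
  have hPhi : ∀ T : Tab K n, Phi1 X n (Finsupp.single T 1) =
      ∑ P : MPath X, coeff1 K (X.box 0).1 P.route • pact1 X T P.map := fun T => by
    simp [Phi1]
  induction z using Finsupp.induction_linear with
  | zero => simp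
  | add x y hx hy => simp only [map_add, hx, hy]
  | single T c =>
    have hc : Finsupp.single T c = c • Finsupp.single T (1 : ℂ) := by simp
    rw [hc]
    simp only [map_smul]
    congr 1
    rw [glAct_single, hPhi]
    simp only [map_sum, map_smul, hPhi, Finset.smul_sum]
    rw [Finset.sum_comm]
    refine Finset.sum_congr rfl fun P _ => ?_
    have hP : _ = TensorProduct.map (Matrix.mulVecLin g) (glAct X.kept n g)
        (pact1 X T P.map) := P.2.sum_smul_pact1 g T
    rw [← hP, Finset.smul_sum]
    exact Finset.sum_congr rfl fun T' _ => smul_comm _ _ _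

lemma castF_glAct {K₁ K₂ : Finset Cell} (h : K₁ = K₂) (g : Matrix (Fin n) (Fin n) ℂ)
    (z : FreeT K₁ n) : castF h (glAct K₁ n g z) = glAct K₂ n g (castF h z) := by
  subst h
  rfl

lemma castF_mem_Rmod {K₁ K₂ : Finset Cell} (h : K₁ = K₂) {z : FreeT K₁ n}
    (hz : z ∈ Rmod K₁ n) : castF h z ∈ Rmod K₂ n := by
  subst h
  exact hz

lemma map_castF_mem_tensR {W : Type} [AddCommGroup W] [Module ℂ W] {K₁ K₂ : Finset Cell}
    (h : K₁ = K₂) {y : W ⊗[ℂ] FreeT K₁ n} (hy : y ∈ tensR W K₁ n) :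
    TensorProduct.map LinearMap.id (castF h).toLinearMap y ∈ tensR W K₂ n := by
  subst h
  have : (castF (n := n) (rfl : K₁ = K₁)).toLinearMap = LinearMap.id := rfl
  rw [this, TensorProduct.map_id]
  exact hy

lemma extMap_ι (g : Matrix (Fin n) (Fin n) ℂ) (v : Fin n → ℂ) :
    extMap n g (ExteriorAlgebra.ι ℂ v) = ExteriorAlgebra.ι ℂ (Matrix.mulVecLin g v) := by
  simp [extMap]

lemma wedgeStep_tmul (a : ExtV n) (v : Fin n → ℂ) :
    wedgeStep n (a ⊗ₜ[ℂ] v) = a * ExteriorAlgebra.ι ℂ v := by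
  simp [wedgeStep]

/-- Wedging the first factor of `V ⊗ F` onto an element of the exterior algebra. -/
def wedgeOn {F : Type*} [AddCommGroup F] [Module ℂ F] :
    ExtV n ⊗[ℂ] ((Fin n → ℂ) ⊗[ℂ] F) →ₗ[ℂ] ExtV n ⊗[ℂ] F :=
  (TensorProduct.map (wedgeStep n) LinearMap.id).comp
    (TensorProduct.assoc ℂ (ExtV n) (Fin n → ℂ) F).symm.toLinearMap

lemma wedgeOn_tmul {F : Type*} [AddCommGroup F] [Module ℂ F] (a : ExtV n) (v : Fin n → ℂ)
    (z : F) : wedgeOn (a ⊗ₜ[ℂ] (v ⊗ₜ[ℂ] z)) = (a * ExteriorAlgebra.ι ℂ v) ⊗ₜ[ℂ] z := by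
  simp [wedgeOn, wedgeStep_tmul]

lemma wedgeOn_map {F : Type*} [AddCommGroup F] [Module ℂ F] (g : Matrix (Fin n) (Fin n) ℂ)
    (φ : F →ₗ[ℂ] F) (y : ExtV n ⊗[ℂ] ((Fin n → ℂ) ⊗[ℂ] F)) :
    wedgeOn (TensorProduct.map (extMap n g).toLinearMap
      (TensorProduct.map (Matrix.mulVecLin g) φ) y) =
      TensorProduct.map (extMap n g).toLinearMap φ (wedgeOn y) := by
  induction y using TensorProduct.induction_on with
  | zero => simp
  | add x y hx hy => simp only [map_add, hx, hy]
  | tmul a y =>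
    induction y using TensorProduct.induction_on with
    | zero => simp
    | add x y hx hy => simp only [TensorProduct.tmul_add, map_add, hx, hy]
    | tmul v z =>
      simp only [TensorProduct.map_tmul, wedgeOn_tmul, AlgHom.toLinearMap_apply, map_mul,
        extMap_ι]

lemma wedgeOn_mem_tensR {K : Finset Cell} (a : ExtV n) {y : (Fin n → ℂ) ⊗[ℂ] FreeT K n}
    (hy : y ∈ tensR (Fin n → ℂ) K n) : wedgeOn (a ⊗ₜ[ℂ] y) ∈ tensR (ExtV n) K n := by
  induction hy using Submodule.span_induction with
  | zero => simp
  | add x y _ _ hx hy =>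
    rw [TensorProduct.tmul_add, map_add]
    exact Submodule.add_mem _ hx hy
  | smul c x _ hx =>
    rw [TensorProduct.tmul_smul, map_smul]
    exact Submodule.smul_mem _ _ hx
  | mem x hx =>
    obtain ⟨v, r, hr, rfl⟩ := hx
    rw [wedgeOn_tmul]
    exact Submodule.subset_span ⟨_, r, hr, rfl⟩

lemma isLowerSet_keptUpTo {K : Finset Cell} {m : ℕ} (X : RemovalOn K m)
    (Xstep : ∀ k : Fin m, RemovalOn (keptUpTo X (k : ℕ)) 1)
    (hkept : ∀ k : Fin m, (Xstep k).kept = keptUpTo X ((k : ℕ) + 1))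
    (hK : IsLowerSet (K : Set Cell)) (k : ℕ) (h : k ≤ m) :
    IsLowerSet (keptUpTo X k : Set Cell) := by
  rcases k with _ | k
  · rwa [← keptUpTo_zero X]
  · have := (Xstep ⟨k, h⟩).lower
    change IsLowerSet ((Xstep ⟨k, h⟩).kept : Set Cell) at this
    rwa [hkept ⟨k, h⟩] at this

section Iter

variable {K : Finset Cell} {m : ℕ} (X : RemovalOn K m)
  (Xstep : ∀ k : Fin m, RemovalOn (keptUpTo X (k : ℕ)) 1)
  (hkept : ∀ k : Fin m, (Xstep k).kept = keptUpTo X ((k : ℕ) + 1))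

/-- One step of the iteration, from `ℱ` to `V ⊗ ℱ` of the next shape. -/
def stepMap (n : ℕ) (k : Fin m) :
    FreeT (keptUpTo X k) n →ₗ[ℂ] (Fin n → ℂ) ⊗[ℂ] FreeT (keptUpTo X ((k : ℕ) + 1)) n :=
  (TensorProduct.map LinearMap.id (castF (hkept k)).toLinearMap).comp (Phi1 (Xstep k) n)

lemma PhiIter_succ_apply (k : ℕ) (h : k + 1 ≤ m) (z : FreeT K n) :
    PhiIter X Xstep hkept n (k + 1) h z =
      wedgeOn (TensorProduct.map LinearMap.id (stepMap X Xstep hkept n ⟨k, h⟩)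
        (PhiIter X Xstep hkept n k (Nat.le_of_succ_le h) z)) := rfl

lemma stepMap_glAct (g : Matrix (Fin n) (Fin n) ℂ) (k : Fin m) (z : FreeT (keptUpTo X k) n) :
    stepMap X Xstep hkept n k (glAct _ n g z) =
      TensorProduct.map (Matrix.mulVecLin g) (glAct _ n g) (stepMap X Xstep hkept n k z) := by
  rw [stepMap, LinearMap.comp_apply, LinearMap.comp_apply, Phi1_glAct]
  generalize Phi1 (Xstep k) n z = y
  induction y using TensorProduct.induction_on with
  | zero => simp
  | add x y hx hy => simp only [map_add, hx, hy]
  | tmul v z =>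
    simp only [TensorProduct.map_tmul, LinearMap.id_apply, LinearEquiv.coe_coe, castF_glAct]

lemma PhiIter_glAct (g : Matrix (Fin n) (Fin n) ℂ) (k : ℕ) (h : k ≤ m) (z : FreeT K n) :
    PhiIter X Xstep hkept n k h (glAct K n g z) =
      TensorProduct.map (extMap n g).toLinearMap (glAct _ n g)
        (PhiIter X Xstep hkept n k h z) := by
  induction k with
  | zero =>
    simp only [PhiIter, LinearMap.comp_apply, LinearEquiv.coe_coe, castF_glAct,
      TensorProduct.mk_apply, TensorProduct.map_tmul, AlgHom.toLinearMap_apply, map_one]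
  | succ k ih =>
    rw [PhiIter_succ_apply, PhiIter_succ_apply, ih (Nat.le_of_succ_le h), ← wedgeOn_map]
    congr 1
    generalize PhiIter X Xstep hkept n k (Nat.le_of_succ_le h) z = y
    induction y using TensorProduct.induction_on with
    | zero => simp
    | add x y hx hy => simp only [map_add, hx, hy]
    | tmul a z =>
      simp only [TensorProduct.map_tmul, LinearMap.id_apply]
      rw [← stepMap_glAct X Xstep hkept g ⟨k, h⟩ z]

lemma PhiIter_mem_tensR (hK : IsLowerSet (K : Set Cell)) (k : ℕ) (h : k ≤ m) {z : FreeT K n}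
    (hz : z ∈ Rmod K n) : PhiIter X Xstep hkept n k h z ∈ tensR (ExtV n) (keptUpTo X k) n := by
  induction k with
  | zero => exact Submodule.subset_span ⟨1, _, castF_mem_Rmod (keptUpTo_zero X) hz, rfl⟩
  | succ k ih =>
    rw [PhiIter_succ_apply]
    have hlow := isLowerSet_keptUpTo X Xstep hkept hK k (Nat.le_of_succ_le h)
    have hmem := ih (Nat.le_of_succ_le h)
    generalize PhiIter X Xstep hkept n k (Nat.le_of_succ_le h) z = y at hmem ⊢
    induction hmem using Submodule.span_induction with
    | zero => simp
    | add x y _ _ hx hy =>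
      rw [map_add, map_add]
      exact Submodule.add_mem _ hx hy
    | smul c x _ hx =>
      rw [map_smul, map_smul]
      exact Submodule.smul_mem _ _ hx
    | mem x hx =>
      obtain ⟨a, r, hr, rfl⟩ := hx
      rw [TensorProduct.map_tmul]
      exact wedgeOn_mem_tensR _ (map_castF_mem_tensR (hkept ⟨k, h⟩)
        (Phi1_mem_tensR (Xstep ⟨k, h⟩) hlow hr))

end Iter

lemma map_mkQ_eq_zero {W : Type} [AddCommGroup W] [Module ℂ W] {K : Finset Cell}
    {y : W ⊗[ℂ] FreeT K n} (hy : y ∈ tensR W K n) :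
    TensorProduct.map (LinearMap.id : W →ₗ[ℂ] W) (Rmod K n).mkQ y = 0 := by
  have hle : tensR W K n ≤
      LinearMap.ker (TensorProduct.map (LinearMap.id : W →ₗ[ℂ] W) (Rmod K n).mkQ) := by
    refine Submodule.span_le.2 ?_
    rintro _ ⟨a, r, hr, rfl⟩
    rw [SetLike.mem_coe, LinearMap.mem_ker, TensorProduct.map_tmul, Submodule.mkQ_apply,
      (Submodule.Quotient.mk_eq_zero _).2 hr, TensorProduct.tmul_zero]
  exact hle hy

end Iteration

/-- The iterated one-box removal map
`Φ₁^m : ℱ_{λ,n} → Λ^m V ⊗ ℱ_{λ∖X,n}` commutes with the `GL_n(ℂ)`-actions and maps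
`R_{λ,n}` into `Λ^m V ⊗ R_{λ∖X,n}`; hence it descends to a (`GL_n(ℂ)`-equivariant)
linear map on the quotients, i.e. a `GL_n(ℂ)`-map `S_λ(V) → Λ^m V ⊗ S_{λ∖X}(V)`.
(The data `Xstep` of the intermediate one-box removals is uniquely determined by the
hypothesis `hXstep`, all the other fields of `RemovalOn` being propositions.) -/
theorem statement12 (μ : YoungDiagram) (n m : ℕ) (X : RemovalOn μ.cells m)
    (Xstep : ∀ k : Fin m, RemovalOn (keptUpTo X (k : ℕ)) 1)
    (hXstep : ∀ k : Fin m, (Xstep k).box 0 = X.box k)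
    (hkept : ∀ k : Fin m, (Xstep k).kept = keptUpTo X ((k : ℕ) + 1)) :
    (∀ g : Matrix.GeneralLinearGroup (Fin n) ℂ,
        (PhiIter X Xstep hkept n m le_rfl).comp (glAct μ.cells n g.val) =
          (TensorProduct.map (extMap n g.val).toLinearMap (glAct X.kept n g.val)).comp
            (PhiIter X Xstep hkept n m le_rfl)) ∧
    (∀ v ∈ Rmod μ.cells n, PhiIter X Xstep hkept n m le_rfl v ∈ tensR (ExtV n) X.kept n) ∧
    ∃ Φbar : (FreeT μ.cells n ⧸ Rmod μ.cells n) →ₗ[ℂ]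
        (ExtV n ⊗[ℂ] (FreeT X.kept n ⧸ Rmod X.kept n)),
      ∀ v : FreeT μ.cells n,
        Φbar (Submodule.Quotient.mk v) =
          TensorProduct.map LinearMap.id (Rmod X.kept n).mkQ
            (PhiIter X Xstep hkept n m le_rfl v) := by
  have hmem : ∀ v ∈ Rmod μ.cells n,
      PhiIter X Xstep hkept n m le_rfl v ∈ tensR (ExtV n) X.kept n := fun v hv =>
    PhiIter_mem_tensR X Xstep hkept μ.isLowerSet m le_rfl hv
  refine ⟨fun g => LinearMap.ext fun z => PhiIter_glAct X Xstep hkept g.val m le_rfl z, hmem,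
    (Rmod μ.cells n).liftQ
      ((TensorProduct.map LinearMap.id (Rmod X.kept n).mkQ).comp
        (PhiIter X Xstep hkept n m le_rfl))
      fun v hv => map_mkQ_eq_zero (hmem v hv), fun v => rfl⟩

end PieriPaper
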